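/- arXiv:1402.2365 — 4 statements merged into one kernel-verified Lean document; each statement's English description precedes it below -/
import Mathlib

section
/- Let γ ∈ (0, 1/L] and let (θ_n)_{n≥0} be the proximal gradient sequence θ_{n+1} = T_γ(θ_n) started from θ_0 ∈ Dom(g). If the sequence (θ_n) remains in a compact set K ⊆ Θ, then: (i) the set 𝓛 is nonempty and every accumulation point of (θ_n) lies in 𝓛 ∩ K; (ii) there exists θ⋆ ∈ 𝓛 ∩ K such that lim_n F(θ_n) = F(θ⋆); (iii) lim_n ‖θ_{n+1} − θ_n‖ = 0. -/
open Filter MeasureTheory Finset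
open scoped InnerProductSpace Topology

noncomputable section

variable {E : Type*} [NormedAddCommGroup E] [InnerProductSpace ℝ E]

/-- Convexity of an `EReal`-valued function `g` (codomain `(-∞, +∞]`). -/
def ERealConvexOn (g : E → EReal) : Prop :=
  ∀ x y : E, ∀ a b : ℝ, 0 ≤ a → 0 ≤ b → a + b = 1 →
    g (a • x + b • y) ≤ (a : EReal) * g x + (b : EReal) * g y

/-- `p` minimizes `v ↦ g v + ‖v - θ‖² / (2γ)`. -/
def IsProxPt (g : E → EReal) (γ : ℝ) (θ p : E) : Prop :=
  ∀ v : E, g p + ((‖p - θ‖ ^ 2 / (2 * γ) : ℝ) : EReal)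
      ≤ g v + ((‖v - θ‖ ^ 2 / (2 * γ) : ℝ) : EReal)

/-- Subdifferential of an `EReal`-valued convex function at `θ`. -/
def subdiff (g : E → EReal) (θ : E) : Set E :=
  {u : E | ∀ v : E, g θ + ((⟪u, v - θ⟫_ℝ : ℝ) : EReal) ≤ g v}

/-- The set `𝓛 = {θ ∈ Dom g : 0 ∈ ∇f(θ) + ∂g(θ)}`. -/
def statPoints (f' : E → E) (g : E → EReal) : Set E :=
  {θ : E | g θ ≠ ⊤ ∧ -f' θ ∈ subdiff g θ}

/-- `F = f + g`, with values in `(-∞, +∞]`. -/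
def Fval (f : E → ℝ) (g : E → EReal) (θ : E) : EReal := (f θ : EReal) + g θ

/-- The real value of `F = f + g` (used at points of the domain of `g`). -/
def Freal (f : E → ℝ) (g : E → EReal) (θ : E) : ℝ := f θ + (g θ).toReal

/-- The proximal gradient map `T_γ(θ) = Prox_γ(θ - γ ∇f(θ))`. -/
def Tmap (prox : ℝ → E → E) (f' : E → E) (γ : ℝ) (θ : E) : E :=
  prox γ (θ - γ • f' θ)

variable [CompleteSpace E]

/-- Standing assumptions: `g` is convex, lower semicontinuous, proper, with values in
`(-∞, +∞]`; `f` is differentiable with `L`-Lipschitz gradient `f'`; and `prox γ θ`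
is the unique minimizer of `v ↦ g v + ‖v - θ‖²/(2γ)` for every `γ > 0`. -/
structure ProxSetting (f : E → ℝ) (f' : E → E) (g : E → EReal) (L : ℝ)
    (prox : ℝ → E → E) : Prop where
  g_ne_bot : ∀ x, g x ≠ ⊥
  g_ne_top : ∃ x, g x ≠ ⊤
  g_lsc : LowerSemicontinuous g
  g_conv : ERealConvexOn g
  f_grad : ∀ x, HasGradientAt f (f' x) x
  L_pos : 0 < L
  lip : ∀ x y, ‖f' x - f' y‖ ≤ L * ‖x - y‖
  prox_spec : ∀ γ : ℝ, 0 < γ → ∀ θ, IsProxPt g γ θ (prox γ θ)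
  prox_unique : ∀ γ : ℝ, 0 < γ → ∀ θ p, IsProxPt g γ θ p → p = prox γ θ

end


lemma aux_prox {E : Type*} [NormedAddCommGroup E] [InnerProductSpace ℝ E]
    (g : E → EReal) (hb : ∀ x, g x ≠ ⊥) (ht : ∃ x, g x ≠ ⊤) (hc : ERealConvexOn g)
    (γ : ℝ) (hγ : 0 < γ) (z p : E) (hp : IsProxPt g γ z p) :
    g p ≠ ⊤ ∧ ∀ v, g v ≠ ⊤ → (g p).toReal + ⟪z - p, v - p⟫_ℝ / γ ≤ (g v).toReal := by
  have hpt : g p ≠ ⊤ := by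
    obtain ⟨x, hx⟩ := ht
    intro h
    have := hp x
    rw [h, EReal.top_add_coe, top_le_iff, ← EReal.coe_toReal hx (hb x), ← EReal.coe_add] at this
    exact EReal.coe_ne_top _ this
  refine ⟨hpt, fun v hv => ?_⟩
  have key : ∀ t : ℝ, 0 < t → t ≤ 1 →
      (g p).toReal + ⟪z - p, v - p⟫_ℝ / γ - t * (‖v - p‖ ^ 2 / (2 * γ)) ≤ (g v).toReal := by
    intro t h0 h1
    have h2 := hc p v (1 - t) t (by linarith) h0.le (by ring)
    have h3 := hp ((1 - t) • p + t • v)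
    have h4 : ((‖((1 - t) • p + t • v) - z‖ ^ 2 / (2 * γ) : ℝ))
        = ‖p - z‖ ^ 2 / (2 * γ) - t * (⟪z - p, v - p⟫_ℝ / γ)
          + t * (t * (‖v - p‖ ^ 2 / (2 * γ))) := by
      have e : ((1 - t) • p + t • v) - z = (p - z) + t • (v - p) := by module
      rw [e, norm_add_sq_real, norm_smul, inner_smul_right, Real.norm_of_nonneg h0.le,
        ← neg_sub p z, inner_neg_left]
      field_simp
      ring
    rw [h4] at h3
    have h5 := h3.trans (add_le_add_left h2 _)
    rw [← EReal.coe_toReal hpt (hb p), ← EReal.coe_toReal hv (hb v)] at h5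
    norm_cast at h5
    have h6 : t * ((g p).toReal + ⟪z - p, v - p⟫_ℝ / γ - t * (‖v - p‖ ^ 2 / (2 * γ)))
        ≤ t * (g v).toReal := by linarith
    exact le_of_mul_le_mul_left h6 h0
  have hl : Tendsto (fun t : ℝ => (g p).toReal + ⟪z - p, v - p⟫_ℝ / γ
      - t * (‖v - p‖ ^ 2 / (2 * γ))) (𝓝[>] 0)
      (𝓝 ((g p).toReal + ⟪z - p, v - p⟫_ℝ / γ - 0 * (‖v - p‖ ^ 2 / (2 * γ)))) := by
    apply Tendsto.mono_left _ nhdsWithin_le_nhds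
    apply Continuous.tendsto
    fun_prop
  have := le_of_tendsto hl (by
    filter_upwards [Ioc_mem_nhdsGT (zero_lt_one (α := ℝ))] with t h
    exact key t h.1 h.2)
  linarith

lemma aux_descent {E : Type*} [NormedAddCommGroup E] [InnerProductSpace ℝ E] [CompleteSpace E]
    (f : E → ℝ) (f' : E → E) (L : ℝ) (hf : ∀ x, HasGradientAt f (f' x) x)
    (lip : ∀ x y, ‖f' x - f' y‖ ≤ L * ‖x - y‖) (x d : E) :
    f (x + d) ≤ f x + ⟪f' x, d⟫_ℝ + L / 2 * ‖d‖ ^ 2 := by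
  let h : ℝ → ℝ := fun t => f (x + t • d) - t * ⟪f' x, d⟫_ℝ - t ^ 2 * (L / 2 * ‖d‖ ^ 2)
  have hd : ∀ t, HasDerivAt h
      (⟪f' (x + t • d), d⟫_ℝ - ⟪f' x, d⟫_ℝ - 2 * t * (L / 2 * ‖d‖ ^ 2)) t := by
    intro t
    have h1 : HasDerivAt (fun t : ℝ => x + t • d) d t := by
      simpa using ((hasDerivAt_id t).smul_const d).const_add x
    have h2 := (hf (x + t • d)).hasFDerivAt.comp_hasDerivAt t h1
    have h3 : HasDerivAt (fun t : ℝ => t * ⟪f' x, d⟫_ℝ) ⟪f' x, d⟫_ℝ t := by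
      simpa using (hasDerivAt_id t).mul_const ⟪f' x, d⟫_ℝ
    have h4 : HasDerivAt (fun t : ℝ => t ^ 2 * (L / 2 * ‖d‖ ^ 2))
        (2 * t * (L / 2 * ‖d‖ ^ 2)) t := by
      simpa using (hasDerivAt_pow 2 t).mul_const (L / 2 * ‖d‖ ^ 2)
    have h5 := (h2.sub h3).sub h4
    simp only [InnerProductSpace.toDual_apply_apply] at h5
    exact h5
  have ha : AntitoneOn h (Set.Icc 0 1) := by
    apply antitoneOn_of_deriv_nonpos (convex_Icc 0 1)
    · exact fun t _ => (hd t).continuousAt.continuousWithinAt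
    · exact fun t _ => (hd t).differentiableAt.differentiableWithinAt
    · intro t ht
      rw [interior_Icc] at ht
      rw [(hd t).deriv, ← inner_sub_left]
      have h1 := real_inner_le_norm (f' (x + t • d) - f' x) d
      have h2 := lip (x + t • d) x
      rw [add_sub_cancel_left, norm_smul, Real.norm_of_nonneg ht.1.le] at h2
      have h3 := mul_le_mul_of_nonneg_right h2 (norm_nonneg d)
      nlinarith
  have := ha (Set.left_mem_Icc.2 zero_le_one) (Set.right_mem_Icc.2 zero_le_one) zero_le_one
  simp only [h] at this
  simp at this
  linarith

/-- **Theorem 2.4** (convergence of the exact proximal gradient algorithm). -/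
theorem stmt0
    {E : Type*} [NormedAddCommGroup E] [InnerProductSpace ℝ E] [FiniteDimensional ℝ E]
    (f : E → ℝ) (f' : E → E) (g : E → EReal) (L : ℝ) (prox : ℝ → E → E)
    (hs : ProxSetting f f' g L prox)
    (γ : ℝ) (hγ0 : 0 < γ) (hγL : γ ≤ 1 / L)
    (θ : ℕ → E) (hθ0 : g (θ 0) ≠ ⊤)
    (hrec : ∀ n : ℕ, θ (n + 1) = Tmap prox f' γ (θ n))
    (K : Set E) (hK : IsCompact K) (hθK : ∀ n, θ n ∈ K) :
    ((statPoints f' g).Nonempty ∧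
        (∀ x : E, MapClusterPt x atTop θ → x ∈ statPoints f' g ∩ K)) ∧
      (∃ θs ∈ statPoints f' g ∩ K,
        Tendsto (fun n => Fval f g (θ n)) atTop (nhds (Fval f g θs))) ∧
      Tendsto (fun n => ‖θ (n + 1) - θ n‖) atTop (nhds 0) := by
  have hγL' : L * γ ≤ 1 := by
    have := (le_div_iff₀ hs.L_pos).1 hγL
    linarith
  have hpr : ∀ n, g (θ (n + 1)) ≠ ⊤ ∧ ∀ v, g v ≠ ⊤ → (g (θ (n + 1))).toReal +
      ⟪θ n - γ • f' (θ n) - θ (n + 1), v - θ (n + 1)⟫_ℝ / γ ≤ (g v).toReal := by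
    intro n
    apply aux_prox g hs.g_ne_bot hs.g_ne_top hs.g_conv γ hγ0
    rw [hrec]
    exact hs.prox_spec γ hγ0 _
  have hfin : ∀ n, g (θ n) ≠ ⊤ := by
    intro n
    cases n with
    | zero => exact hθ0
    | succ n => exact (hpr n).1
  have hfc : Continuous f := continuous_iff_continuousAt.2 fun x => (hs.f_grad x).continuousAt
  have hf'c : Continuous f' := by
    have : LipschitzWith (Real.toNNReal L) f' := by
      apply LipschitzWith.of_dist_le_mul
      intro x y
      rw [dist_eq_norm, dist_eq_norm, Real.coe_toNNReal _ hs.L_pos.le]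
      exact hs.lip x y
    exact this.continuous
  set F : ℕ → ℝ := fun n => f (θ n) + (g (θ n)).toReal with hF
  have hdec : ∀ n, F (n + 1) + ‖θ (n + 1) - θ n‖ ^ 2 / (2 * γ) ≤ F n := by
    intro n
    have h1 := (hpr n).2 (θ n) (hfin n)
    have h2 := aux_descent f f' L hs.f_grad hs.lip (θ n) (θ (n + 1) - θ n)
    rw [add_sub_cancel] at h2
    have e : ⟪θ n - γ • f' (θ n) - θ (n + 1), θ n - θ (n + 1)⟫_ℝ / γ =
        ‖θ (n + 1) - θ n‖ ^ 2 / γ + ⟪f' (θ n), θ (n + 1) - θ n⟫_ℝ := by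
      have e1 : θ n - γ • f' (θ n) - θ (n + 1) = -((θ (n + 1) - θ n) + γ • f' (θ n)) := by module
      rw [e1, ← neg_sub (θ (n + 1)) (θ n), inner_neg_neg, inner_add_left, inner_smul_left,
        real_inner_self_eq_norm_sq]
      simp only [conj_trivial]
      field_simp
    rw [e] at h1
    have h3 : L / 2 * ‖θ (n + 1) - θ n‖ ^ 2 ≤ ‖θ (n + 1) - θ n‖ ^ 2 / (2 * γ) := by
      rw [le_div_iff₀ (by positivity)]
      nlinarith [sq_nonneg ‖θ (n + 1) - θ n‖]
    have h4 : ‖θ (n + 1) - θ n‖ ^ 2 / γ = ‖θ (n + 1) - θ n‖ ^ 2 / (2 * γ)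
        + ‖θ (n + 1) - θ n‖ ^ 2 / (2 * γ) := by
      field_simp
      norm_num
    simp only [hF]
    linarith
  have hanti : Antitone F := antitone_nat_of_succ_le fun n => by
    have := hdec n
    have : 0 ≤ ‖θ (n + 1) - θ n‖ ^ 2 / (2 * γ) := by positivity
    linarith
  have hbdd : BddBelow (Set.range F) := by
    have hcont : Continuous fun v => f v + ((g (θ 1)).toReal +
        ⟪θ 0 - γ • f' (θ 0) - θ 1, v - θ 1⟫_ℝ / γ) := by fun_prop
    obtain ⟨m, hm⟩ := hK.bddBelow_image hcont.continuousOn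
    refine ⟨m, ?_⟩
    rintro _ ⟨n, rfl⟩
    have h1 := hm (Set.mem_image_of_mem _ (hθK n))
    have h2 := (hpr 0).2 (θ n) (hfin n)
    simp only [hF]
    simp only [zero_add] at h2
    linarith
  obtain ⟨l, hl⟩ : ∃ l, Tendsto F atTop (𝓝 l) := ⟨_, tendsto_atTop_ciInf hanti hbdd⟩
  have hl1 : Tendsto (fun n => F (n + 1)) atTop (𝓝 l) := (tendsto_add_atTop_iff_nat 1).2 hl
  have hstep : Tendsto (fun n => ‖θ (n + 1) - θ n‖) atTop (𝓝 0) := by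
    have h1 : Tendsto (fun n => 2 * γ * (F n - F (n + 1))) atTop (𝓝 0) := by
      simpa using (hl.sub hl1).const_mul (2 * γ)
    have h2 : Tendsto (fun n => ‖θ (n + 1) - θ n‖ ^ 2) atTop (𝓝 0) := by
      refine squeeze_zero (fun n => by positivity) (fun n => ?_) h1
      have := hdec n
      have h3 : ‖θ (n + 1) - θ n‖ ^ 2 / (2 * γ) ≤ F n - F (n + 1) := by linarith
      rw [div_le_iff₀ (by positivity)] at h3
      linarith
    have h3 := h2.sqrt
    simpa [Real.sqrt_sq] using h3
  have hmain : ∀ x : E, MapClusterPt x atTop θ →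
      x ∈ statPoints f' g ∩ K ∧ Tendsto (fun n => Fval f g (θ n)) atTop (𝓝 (Fval f g x)) := by
    intro x hx
    obtain ⟨φ, hφ, hφx⟩ := MapClusterPt.tendsto_subseq hx
    have hxK : x ∈ K := hK.isClosed.mem_of_tendsto hφx (Eventually.of_forall fun k => hθK _)
    have hd : Tendsto (fun k => θ (φ k + 1) - θ (φ k)) atTop (𝓝 0) :=
      tendsto_zero_iff_norm_tendsto_zero.2 (hstep.comp hφ.tendsto_atTop)
    have hφx1 : Tendsto (fun k => θ (φ k + 1)) atTop (𝓝 x) := by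
      simpa using hd.add hφx
    have hin : ∀ v, Tendsto (fun k => ⟪θ (φ k) - γ • f' (θ (φ k)) - θ (φ k + 1),
        v - θ (φ k + 1)⟫_ℝ / γ) atTop (𝓝 (⟪-f' x, v - x⟫_ℝ)) := by
      intro v
      have h1 : Tendsto (fun k => f' (θ (φ k))) atTop (𝓝 (f' x)) :=
        (hf'c.tendsto x).comp hφx
      have h2 := (((hφx.sub (h1.const_smul γ)).sub hφx1).inner (𝕜 := ℝ)
        (hφx1.const_sub v)).div_const γ
      refine (congrArg (fun r => Tendsto _ atTop (𝓝 r)) ?_).mp h2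
      have e : x - γ • f' x - x = γ • (- f' x) := by module
      rw [e, inner_smul_left]
      simp only [conj_trivial]
      field_simp
    have hclosed : ∀ (a : ℕ → ℝ) (b : ℝ), Tendsto a atTop (𝓝 b) →
        (∀ k, (g (θ (φ k + 1))).toReal ≤ a k) → g x ≤ (b : EReal) := by
      intro a b hab hle
      have h1 : Tendsto (fun k => (θ (φ k + 1), (a k : EReal))) atTop (𝓝 (x, (b : EReal))) :=
        hφx1.prodMk_nhds ((continuous_coe_real_ereal.tendsto b).comp hab)
      have h2 := hs.g_lsc.isClosed_epigraph.mem_of_tendsto h1 (Eventually.of_forall fun k => by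
        show g (θ (φ k + 1)) ≤ (a k : EReal)
        rw [← EReal.coe_toReal (hfin (φ k + 1)) (hs.g_ne_bot _)]
        exact EReal.coe_le_coe_iff.2 (hle k))
      exact h2
    have hsub : ∀ v, g v ≠ ⊤ → g x ≤ (((g v).toReal - ⟪-f' x, v - x⟫_ℝ : ℝ) : EReal) := by
      intro v hv
      refine hclosed _ _ ((hin v).const_sub (g v).toReal) fun k => ?_
      have := (hpr (φ k)).2 v hv
      linarith
    have hgx : g x ≠ ⊤ := ne_top_of_le_ne_top (EReal.coe_ne_top _) (hsub _ hθ0)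
    have hGx : g x = ((g x).toReal : EReal) := (EReal.coe_toReal hgx (hs.g_ne_bot x)).symm
    refine ⟨⟨⟨hgx, fun v => ?_⟩, hxK⟩, ?_⟩
    · by_cases hv : g v = ⊤
      · rw [hv]; exact le_top
      · have h1 := hsub v hv
        rw [hGx, EReal.coe_le_coe_iff] at h1
        rw [hGx, ← EReal.coe_toReal hv (hs.g_ne_bot v), ← EReal.coe_add, EReal.coe_le_coe_iff]
        linarith
    · have hGt : Tendsto (fun k => (g (θ (φ k + 1))).toReal) atTop (𝓝 (l - f x)) := by
        have h1 : Tendsto (fun k => F (φ k + 1)) atTop (𝓝 l) := hl1.comp hφ.tendsto_atTop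
        have h2 : Tendsto (fun k => f (θ (φ k + 1))) atTop (𝓝 (f x)) :=
          (hfc.tendsto x).comp hφx1
        simpa [hF] using h1.sub h2
      have h1 : (g x).toReal ≤ l - f x := by
        have := hclosed _ _ hGt fun k => le_rfl
        rwa [hGx, EReal.coe_le_coe_iff] at this
      have h2 : l - f x ≤ (g x).toReal := by
        have := le_of_tendsto (hGt.add (hin x)) (Eventually.of_forall fun k => (hpr (φ k)).2 x hgx)
        simpa using this
      have h3 : Fval f g x = (l : EReal) := by
        rw [Fval, hGx, ← EReal.coe_add]
        congr 1
        linarith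
      have h4 : (fun n => Fval f g (θ n)) = fun n => ((F n : ℝ) : EReal) := by
        funext n
        rw [Fval, hF, EReal.coe_add, EReal.coe_toReal (hfin n) (hs.g_ne_bot _)]
      rw [h3, h4]
      exact (continuous_coe_real_ereal.tendsto l).comp hl
  obtain ⟨x, -, hx⟩ := hK.exists_mapClusterPt (f := atTop) (u := θ)
    (Filter.le_principal_iff.2 (Filter.mem_map.2 (Filter.univ_mem' hθK)))
  exact ⟨⟨⟨x, (hmain x hx).1.1⟩, fun y hy => (hmain y hy).1⟩, ⟨x, hmain x hx⟩, hstep⟩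
end

section
/- Let γ ∈ (0, 1/L] and let (θ_n)_{n≥0} be the perturbed proximal gradient sequence with constant step size γ_n = γ. Assume that the set 𝓛 is nonempty, that sup_n ‖θ_n‖ < ∞, and that lim_n η_n = 0. Then the set of limit points of the real sequence (F(θ_n))_n is contained in a single connected component of the set F(𝓛) ⊆ ℝ. If in addition F(𝓛) has empty interior in ℝ, then there exists θ⋆ ∈ 𝓛 such that (i) lim_n F(θ_n) = F(θ⋆), and (ii) the distance from θ_n to the set 𝓛 ∩ {θ : F(θ) = F(θ⋆)} tends to 0. -/
open Filter MeasureTheory Finset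
open scoped InnerProductSpace Topology

section Helpers

theorem hp_real_seq (x e : ℕ → ℝ) (S : Set ℝ) (hb : ∃ B, ∀ n, |x n| ≤ B)
    (he : Tendsto e atTop (𝓝 0)) (hstep : ∀ n, x (n+1) ≤ x n + e n)
    (hS : ∀ c, c ∉ S → ∃ ε > 0, ∀ᶠ n in atTop, |x n - c| < ε → x (n+1) ≤ x n - ε) :
    ∃ a b, a ≤ b ∧ Set.Icc a b ⊆ S ∧ ∀ τ > 0, ∀ᶠ n in atTop, a - τ < x n ∧ x n < b + τ := by
  obtain ⟨B, hB⟩ := hb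
  have bu : IsBoundedUnder (· ≤ ·) atTop x :=
    isBoundedUnder_of ⟨B, fun n => (abs_le.1 (hB n)).2⟩
  have bl : IsBoundedUnder (· ≥ ·) atTop x :=
    isBoundedUnder_of ⟨-B, fun n => (abs_le.1 (hB n)).1⟩
  have cu := bl.isCoboundedUnder_le
  have cl := bu.isCoboundedUnder_ge
  have hab : liminf x atTop ≤ limsup x atTop := liminf_le_limsup bu bl
  have hev : ∀ τ > 0, ∀ᶠ n in atTop, liminf x atTop - τ < x n ∧ x n < limsup x atTop + τ := by
    intro τ hτ
    exact (eventually_lt_of_lt_liminf (by linarith) bl).and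
      (eventually_lt_of_limsup_lt (by linarith) bu)
  refine ⟨liminf x atTop, limsup x atTop, hab, ?_, hev⟩
  intro c hc
  by_contra hcS
  obtain ⟨ε, hε, hw⟩ := hS c hcS
  rcases hab.eq_or_lt with h | h
  · have hca : c = liminf x atTop := le_antisymm (by rw [h]; exact hc.2) hc.1
    rw [← h, ← hca] at hev
    have h1 := hev (ε/2) (by linarith)
    have h2 := (tendsto_add_atTop_nat 1).eventually h1
    obtain ⟨n, hn1, hn2, hn3⟩ := (hw.and (h1.and h2)).exists
    have := hn1 (abs_lt.2 ⟨by linarith [hn2.1], by linarith [hn2.2]⟩)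
    linarith [hn2.2, hn3.1]
  · obtain ⟨d, hd1, hd2⟩ : ∃ d, max (c - ε) (liminf x atTop) < d ∧
        d < min (c + ε) (limsup x atTop) := by
      apply _root_.exists_between
      simp only [max_lt_iff, lt_min_iff]
      refine ⟨⟨by linarith, by linarith [hc.1]⟩, by linarith [hc.2], h⟩
    simp only [max_lt_iff, lt_min_iff] at hd1 hd2
    have f1 : ∃ᶠ n in atTop, x n < d := frequently_lt_of_liminf_lt cl hd1.2
    have f2 : ∃ᶠ n in atTop, d < x n := frequently_lt_of_lt_limsup cu hd2.2
    have he' : ∀ᶠ n in atTop, e n < d - (c - ε) := he.eventually (gt_mem_nhds (by linarith))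
    obtain ⟨N, hN⟩ := eventually_atTop.1 (hw.and he')
    obtain ⟨n, hnN, hn⟩ := frequently_atTop.1 f1 N
    have hinv : ∀ m ≥ n, x m ≤ d := by
      intro m hm
      induction m, hm using Nat.le_induction with
      | base => exact hn.le
      | succ m hm ih =>
        have := hN m (by omega)
        by_cases hx : x m ≤ c - ε
        · linarith [hstep m]
        · push Not at hx
          have := this.1 (abs_lt.2 ⟨by linarith, by linarith⟩)
          linarith
    obtain ⟨m, hm, hm'⟩ := frequently_atTop.1 f2 n
    linarith [hinv m hm]

variable {E : Type*} [NormedAddCommGroup E] [InnerProductSpace ℝ E]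

theorem hp_subdiff_real {g : E → EReal} {p u v : E} (hb : ∀ x, g x ≠ ⊥) (hp : g p ≠ ⊤)
    (hv : g v ≠ ⊤) (hu : u ∈ subdiff g p) :
    (g p).toReal + ⟪u, v - p⟫_ℝ ≤ (g v).toReal := by
  have := hu v
  rw [← EReal.coe_toReal hp (hb p), ← EReal.coe_toReal hv (hb v)] at this
  exact_mod_cast this

theorem hp_prox {g : E → EReal} {γ : ℝ} {z p : E} (hb : ∀ x, g x ≠ ⊥) (hg : ∃ x, g x ≠ ⊤)
    (hc : ERealConvexOn g) (hγ : 0 < γ) (h : IsProxPt g γ z p) :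
    g p ≠ ⊤ ∧ γ⁻¹ • (z - p) ∈ subdiff g p := by
  have hp : g p ≠ ⊤ := by
    obtain ⟨x, hx⟩ := hg
    intro hp
    have := h x
    rw [hp, ← EReal.coe_toReal hx (hb x), EReal.top_add_coe, top_le_iff] at this
    exact EReal.coe_ne_top _ (by exact_mod_cast this)
  refine ⟨hp, ?_⟩
  intro v
  by_cases hv : g v = ⊤
  · rw [hv]; exact le_top
  have key : ∀ t : ℝ, 0 < t → t < 1 →
      (g p).toReal + ⟪γ⁻¹ • (z - p), v - p⟫_ℝ ≤ (g v).toReal + t * (‖v - p‖^2 / (2*γ)) := by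
    intro t ht ht1
    have h1 := h ((1-t) • p + t • v)
    have h2 := hc p v (1-t) t (by linarith) ht.le (by ring)
    rw [← EReal.coe_toReal hp (hb p), ← EReal.coe_toReal hv (hb v)] at h2
    have h3 : g ((1-t) • p + t • v) ≠ ⊤ := by
      intro h3
      rw [h3, top_le_iff] at h2
      exact EReal.coe_ne_top ((1-t) * (g p).toReal + t * (g v).toReal) (by exact_mod_cast h2)
    rw [← EReal.coe_toReal h3 (hb _)] at h1 h2
    rw [← EReal.coe_toReal hp (hb p)] at h1
    have h1' : (g p).toReal + ‖p - z‖ ^ 2 / (2 * γ) ≤ (g ((1-t) • p + t • v)).toReal +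
      ‖(1-t) • p + t • v - z‖ ^ 2 / (2 * γ) := by exact_mod_cast h1
    have h2' : (g ((1-t) • p + t • v)).toReal ≤ (1-t) * (g p).toReal + t * (g v).toReal := by
      exact_mod_cast h2
    have h4 : (1-t) • p + t • v - z = (p - z) + t • (v - p) := by module
    have h5 : ‖(p - z) + t • (v - p)‖^2 = ‖p - z‖^2 + 2 * t * ⟪p - z, v - p⟫_ℝ + t^2 * ‖v-p‖^2 := by
      rw [norm_add_sq_real, inner_smul_right, norm_smul, mul_pow, Real.norm_eq_abs, sq_abs]; ring
    rw [h4, h5] at h1'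
    rw [inner_smul_left]
    have h6 : ⟪z - p, v - p⟫_ℝ = - ⟪p - z, v - p⟫_ℝ := by
      rw [← inner_neg_left, neg_sub]
    rw [h6]
    simp only [conj_trivial]
    have h7 : (‖p - z‖^2 + 2 * t * ⟪p - z, v - p⟫_ℝ + t^2 * ‖v-p‖^2) / (2*γ) =
      ‖p - z‖^2/(2*γ) + t * (γ⁻¹ * ⟪p - z, v - p⟫_ℝ) + t * (t * (‖v-p‖^2/(2*γ))) := by
      field_simp
    rw [h7] at h1'
    refine le_of_mul_le_mul_left ?_ ht
    linarith
  have lim : Tendsto (fun t : ℝ => (g v).toReal + t * (‖v - p‖^2 / (2*γ))) (𝓝[>] 0)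
      (𝓝 ((g v).toReal)) := by
    have : Tendsto (fun t : ℝ => (g v).toReal + t * (‖v - p‖^2 / (2*γ))) (𝓝 0)
      (𝓝 ((g v).toReal + 0 * (‖v - p‖^2 / (2*γ)))) := by
      apply Continuous.tendsto; fun_prop
    simp only [zero_mul, add_zero] at this
    exact this.mono_left nhdsWithin_le_nhds
  have fin : (g p).toReal + ⟪γ⁻¹ • (z - p), v - p⟫_ℝ ≤ (g v).toReal := by
    refine ge_of_tendsto lim ?_
    filter_upwards [Ioo_mem_nhdsGT (show (0:ℝ) < 1 by norm_num)] with t ht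
    exact key t ht.1 ht.2
  rw [← EReal.coe_toReal hp (hb p), ← EReal.coe_toReal hv (hb v)]
  exact_mod_cast fin

theorem hp_closed {g : E → EReal} (hb : ∀ x, g x ≠ ⊥) (hg : ∃ x, g x ≠ ⊤)
    (hl : LowerSemicontinuous g) {p u : ℕ → E} {p0 u0 : E} (hp : Tendsto p atTop (𝓝 p0))
    (hu : Tendsto u atTop (𝓝 u0)) (hpt : ∀ k, g (p k) ≠ ⊤) (hs : ∀ k, u k ∈ subdiff g (p k)) :
    g p0 ≠ ⊤ ∧ u0 ∈ subdiff g p0 ∧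
      Tendsto (fun k => (g (p k)).toReal) atTop (𝓝 (g p0).toReal) := by
  have lim : ∀ v, Tendsto (fun k => (g v).toReal - ⟪u k, v - p k⟫_ℝ) atTop
      (𝓝 ((g v).toReal - ⟪u0, v - p0⟫_ℝ)) := fun v =>
    tendsto_const_nhds.sub (hu.inner (tendsto_const_nhds.sub hp))
  have lo : ∀ c : ℝ, (c : EReal) < g p0 → ∀ᶠ k in atTop, c < (g (p k)).toReal := by
    intro c hc
    filter_upwards [hp.eventually (hl p0 c hc)] with k hk
    rw [← EReal.coe_toReal (hpt k) (hb _)] at hk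
    exact_mod_cast hk
  have key : ∀ v, g v ≠ ⊤ → g p0 ≤ (((g v).toReal - ⟪u0, v - p0⟫_ℝ : ℝ) : EReal) := by
    intro v hv
    refine EReal.ge_of_forall_gt_iff_ge.1 ?_
    intro c hc
    have : c ≤ (g v).toReal - ⟪u0, v - p0⟫_ℝ := by
      refine ge_of_tendsto (lim v) ?_
      filter_upwards [lo c hc] with k hk
      linarith [hp_subdiff_real hb (hpt k) hv (hs k)]
    exact_mod_cast this
  have hp0 : g p0 ≠ ⊤ := by
    obtain ⟨x, hx⟩ := hg
    exact ne_top_of_le_ne_top (EReal.coe_ne_top _) (key x hx)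
  refine ⟨hp0, ?_, ?_⟩
  · intro v
    by_cases hv : g v = ⊤
    · rw [hv]; exact le_top
    have := key v hv
    rw [← EReal.coe_toReal hp0 (hb p0)] at this ⊢
    rw [← EReal.coe_toReal hv (hb v)]
    have : (g p0).toReal ≤ (g v).toReal - ⟪u0, v - p0⟫_ℝ := by exact_mod_cast this
    have : (g p0).toReal + ⟪u0, v - p0⟫_ℝ ≤ (g v).toReal := by linarith
    exact_mod_cast this
  · have l2 := lim p0
    simp only [sub_self, inner_zero_right, sub_zero] at l2
    rw [tendsto_order]
    constructor
    · intro c hc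
      apply lo
      rw [← EReal.coe_toReal hp0 (hb p0)]
      exact_mod_cast hc
    · intro c hc
      filter_upwards [l2.eventually (gt_mem_nhds hc)] with k hk
      linarith [hp_subdiff_real hb (hpt k) hp0 (hs k)]

theorem hp_descent [CompleteSpace E] {f : E → ℝ} {f' : E → E} {L : ℝ}
    (hf : ∀ x, HasGradientAt f (f' x) x)
    (hL : ∀ x y, ‖f' x - f' y‖ ≤ L * ‖x - y‖) (x y : E) :
    f y ≤ f x + ⟪f' x, y - x⟫_ℝ + L / 2 * ‖y - x‖^2 := by
  set d := y - x with hd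
  have hder : ∀ t : ℝ, HasDerivAt (fun t : ℝ => f (x + t • d) - t * ⟪f' x, d⟫_ℝ
      - L/2 * t^2 * ‖d‖^2) (⟪f' (x + t • d), d⟫_ℝ - ⟪f' x, d⟫_ℝ - L * t * ‖d‖^2) t := by
    intro t
    have h1 : HasDerivAt (fun t : ℝ => x + t • d) d t := by
      simpa using ((hasDerivAt_id t).smul_const d).const_add x
    have h2 := (hf (x + t • d)).hasFDerivAt.comp_hasDerivAt t h1
    simp only [InnerProductSpace.toDual_apply_apply] at h2
    have h3 : HasDerivAt (fun t : ℝ => t * ⟪f' x, d⟫_ℝ) ⟪f' x, d⟫_ℝ t := by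
      simpa using (hasDerivAt_id t).mul_const ⟪f' x, d⟫_ℝ
    have h4 : HasDerivAt (fun t : ℝ => L/2 * t^2 * ‖d‖^2) (L * t * ‖d‖^2) t := by
      have := ((hasDerivAt_pow 2 t).const_mul (L/2)).mul_const (‖d‖^2)
      have e : L/2 * ((2:ℕ) * t^(2-1)) * ‖d‖^2 = L * t * ‖d‖^2 := by
        push_cast; simp only [Nat.add_one_sub_one, pow_one]; ring
      rw [e] at this
      exact this
    exact (h2.sub h3).sub h4
  have hanti := antitoneOn_of_deriv_nonpos (convex_Icc (0:ℝ) 1)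
    (fun t _ => (hder t).continuousAt.continuousWithinAt)
    (fun t _ => (hder t).differentiableAt.differentiableWithinAt) (by
      intro t ht
      rw [interior_Icc] at ht
      rw [(hder t).deriv]
      have h1 : ⟪f' (x + t • d) - f' x, d⟫_ℝ ≤ ‖f' (x + t • d) - f' x‖ * ‖d‖ :=
        real_inner_le_norm _ _
      have h2 := hL (x + t • d) x
      rw [add_sub_cancel_left, norm_smul, Real.norm_eq_abs, abs_of_pos ht.1] at h2
      rw [inner_sub_left] at h1
      have := mul_le_mul_of_nonneg_right h2 (norm_nonneg d)
      nlinarith)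
  have := hanti (Set.left_mem_Icc.2 zero_le_one) (Set.right_mem_Icc.2 zero_le_one) zero_le_one
  have hy : x + d = y := by rw [hd]; abel
  simp [hy] at this
  linarith

end Helpers

/-- **Theorem 3.1** (perturbed proximal gradient, possibly non-convex `f`). -/
theorem stmt2
    {E : Type*} [NormedAddCommGroup E] [InnerProductSpace ℝ E] [FiniteDimensional ℝ E]
    (f : E → ℝ) (f' : E → E) (g : E → EReal) (L : ℝ) (prox : ℝ → E → E)
    (hs : ProxSetting f f' g L prox)
    (γ : ℝ) (hγ0 : 0 < γ) (hγL : γ ≤ 1 / L)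
    (θ H η : ℕ → E) (hθ0 : g (θ 0) ≠ ⊤)
    (hrec : ∀ n : ℕ, θ (n + 1) = prox γ (θ n - γ • H (n + 1)))
    (hη : ∀ n : ℕ, η (n + 1) = H (n + 1) - f' (θ n))
    (hLne : (statPoints f' g).Nonempty)
    (hbd : ∃ C : ℝ, ∀ n, ‖θ n‖ ≤ C)
    (hη0 : Tendsto η atTop (nhds 0)) :
    (∃ x ∈ Fval f g '' statPoints f' g,
        ∀ y : EReal, MapClusterPt y atTop (fun n => Fval f g (θ n)) →
          y ∈ connectedComponentIn (Fval f g '' statPoints f' g) x) ∧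
      (interior {x : ℝ | (x : EReal) ∈ Fval f g '' statPoints f' g} = ∅ →
        ∃ θs ∈ statPoints f' g,
          Tendsto (fun n => Fval f g (θ n)) atTop (nhds (Fval f g θs)) ∧
            Tendsto
              (fun n => Metric.infDist (θ n)
                (statPoints f' g ∩ {v : E | Fval f g v = Fval f g θs}))
              atTop (nhds 0)) := by

  haveI : CompleteSpace E := FiniteDimensional.complete ℝ E
  have hb := hs.g_ne_bot
  have hLpos := hs.L_pos
  obtain ⟨C, hC⟩ := hbd
  have hf'c : Continuous f' := by
    have : LipschitzWith (Real.toNNReal L) f' := LipschitzWith.of_dist_le_mul (fun x y => by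
      rw [dist_eq_norm, dist_eq_norm, Real.coe_toNNReal _ hLpos.le]; exact hs.lip x y)
    exact this.continuous
  have hfc : Continuous f := continuous_iff_continuousAt.2 fun x => (hs.f_grad x).continuousAt
  -- shifted noise
  have hη1 : Tendsto (fun n => η (n+1)) atTop (𝓝 0) := hη0.comp (tendsto_add_atTop_nat 1)
  -- subgradients
  set u : ℕ → E := fun n => γ⁻¹ • (θ n - θ (n+1)) - η (n+1) - f' (θ n) with hu
  have hprox : ∀ n, g (θ (n+1)) ≠ ⊤ ∧ u n ∈ subdiff g (θ (n+1)) := by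
    intro n
    have h := hp_prox hb hs.g_ne_top hs.g_conv hγ0 (hs.prox_spec γ hγ0 (θ n - γ • H (n+1)))
    rw [← hrec n] at h
    refine ⟨h.1, ?_⟩
    have e : u n = γ⁻¹ • (θ n - γ • H (n + 1) - θ (n + 1)) := by
      simp only [hu, hη n]
      rw [show θ n - γ • H (n + 1) - θ (n + 1) = (θ n - θ (n+1)) - γ • H (n+1) by abel,
        smul_sub _ _ (γ • H (n+1)), smul_smul, inv_mul_cancel₀ hγ0.ne', one_smul]
      abel
    rw [e]; exact h.2
  have hfin : ∀ n, g (θ n) ≠ ⊤ := by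
    intro n
    cases n with
    | zero => exact hθ0
    | succ n => exact (hprox n).1
  have hFr : ∀ p, g p ≠ ⊤ → Fval f g p = ((Freal f g p : ℝ) : EReal) := by
    intro p hp
    unfold Fval Freal
    rw [EReal.coe_add, EReal.coe_toReal hp (hb p)]
  set x : ℕ → ℝ := fun n => Freal f g (θ n) with hx
  have hdesc : ∀ n, x (n+1) ≤ x n - ‖θ n - θ (n+1)‖^2 / (2*γ)
      + ‖η (n+1)‖ * ‖θ n - θ (n+1)‖ := by
    intro n
    have h1 := hp_subdiff_real hb (hprox n).1 (hfin n) (hprox n).2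
    have h2 := hp_descent hs.f_grad hs.lip (θ n) (θ (n+1))
    rw [← neg_sub (θ n), inner_neg_right, norm_neg] at h2
    simp only [hu, inner_sub_left, inner_smul_left, conj_trivial] at h1
    rw [← inner_sub_left, real_inner_self_eq_norm_sq] at h1
    have h3 : -⟪η (n+1), θ n - θ (n+1)⟫_ℝ ≥ - (‖η (n+1)‖ * ‖θ n - θ (n+1)‖) :=
      neg_le_neg (real_inner_le_norm _ _)
    have h4 : L / 2 * ‖θ n - θ (n+1)‖^2 ≤ γ⁻¹ / 2 * ‖θ n - θ (n+1)‖^2 := by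
      apply mul_le_mul_of_nonneg_right _ (sq_nonneg _)
      have : L ≤ γ⁻¹ := by
        rw [le_inv_comm₀ hLpos hγ0, ← one_div]; exact hγL
      linarith
    have h5 : ‖θ n - θ (n+1)‖^2 / (2*γ) = γ⁻¹ / 2 * ‖θ n - θ (n+1)‖^2 := by
      field_simp
    simp only [hx, Freal]
    rw [h5]
    linarith
  set e : ℕ → ℝ := fun n => ‖η (n+1)‖ * (2 * C) with hedef
  have he : Tendsto e atTop (𝓝 0) := by
    have := hη1.norm.mul_const (2*C)
    simpa using this
  have hΔC : ∀ n, ‖θ n - θ (n+1)‖ ≤ 2 * C := fun n => by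
    linarith [norm_sub_le (θ n) (θ (n+1)), hC n, hC (n+1)]
  have hsq : ∀ n, ‖θ n - θ (n+1)‖^2 ≤ (2*γ) * (x n - x (n+1) + e n) := by
    intro n
    have h1 := hdesc n
    have h2 := mul_le_mul_of_nonneg_left (hΔC n) (norm_nonneg (η (n+1)))
    have h3 : ‖θ n - θ (n+1)‖^2 / (2*γ) ≤ x n - x (n+1) + e n := by
      simp only [hedef]; linarith
    rw [div_le_iff₀ (by linarith)] at h3
    linarith
  have hstep : ∀ n, x (n+1) ≤ x n + e n := by
    intro n
    have h1 := (sq_nonneg _).trans (hsq n)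
    have := nonneg_of_mul_nonneg_right h1 (by linarith : (0:ℝ) < 2*γ)
    linarith
  -- boundedness
  have hbx : ∃ B, ∀ n, |x n| ≤ B := by
    obtain ⟨q, hq, hq'⟩ := hLne
    have hK := isCompact_closedBall (0:E) C
    obtain ⟨B1, hB1⟩ := hK.exists_bound_of_continuousOn hfc.continuousOn
    obtain ⟨B2, hB2⟩ := hK.exists_bound_of_continuousOn hf'c.continuousOn
    obtain ⟨B3, hB3⟩ := (Metric.isBounded_range_of_tendsto _ hη1).exists_norm_le
    have hm : ∀ n, θ n ∈ Metric.closedBall (0:E) C := fun n => by simpa using hC n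
    have hd : ∀ n, ‖q - θ n‖ ≤ ‖q‖ + C := fun n => (norm_sub_le _ _).trans (by linarith [hC n])
    have hun : ∀ n, ‖u n‖ ≤ γ⁻¹ * (2*C) + B3 + B2 := by
      intro n
      have h1 : ‖γ⁻¹ • (θ n - θ (n+1))‖ ≤ γ⁻¹ * (2*C) := by
        rw [norm_smul, Real.norm_eq_abs, abs_of_pos (inv_pos.2 hγ0)]
        exact mul_le_mul_of_nonneg_left (hΔC n) (inv_pos.2 hγ0).le
      have h2 := norm_sub_le (γ⁻¹ • (θ n - θ (n+1)) - η (n+1)) (f' (θ n))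
      have h3 := norm_sub_le (γ⁻¹ • (θ n - θ (n+1))) (η (n+1))
      linarith [hB3 _ (Set.mem_range_self n), hB2 _ (hm n)]
    have hup : ∀ n, x (n+1) ≤ B1 + (g q).toReal + (γ⁻¹ * (2*C) + B3 + B2) * (‖q‖ + C) := by
      intro n
      have h1 := hp_subdiff_real hb (hprox n).1 hq (hprox n).2
      have h2 := (abs_le.1 (abs_real_inner_le_norm (u n) (q - θ (n+1)))).1
      have h3 := mul_le_mul (hun n) (hd (n+1)) (norm_nonneg _) ((norm_nonneg _).trans (hun n))
      have h4 := (abs_le.1 (hB1 _ (hm (n+1)))).2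
      simp only [hx, Freal]
      linarith
    have hlo : ∀ n, -B1 + (g q).toReal - ‖f' q‖ * (‖q‖ + C) ≤ x n := by
      intro n
      have h1 := hp_subdiff_real hb hq (hfin n) hq'
      have h2 := (abs_le.1 (abs_real_inner_le_norm (-f' q) (θ n - q))).1
      rw [norm_neg, norm_sub_rev] at h2
      have h3 := mul_le_mul_of_nonneg_left (hd n) (norm_nonneg (f' q))
      have h4 := (abs_le.1 (hB1 _ (hm n))).1
      simp only [hx, Freal]
      linarith
    refine ⟨|x 0| + |B1 + (g q).toReal + (γ⁻¹ * (2*C) + B3 + B2) * (‖q‖ + C)|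
      + |-B1 + (g q).toReal - ‖f' q‖ * (‖q‖ + C)|, ?_⟩
    intro n
    have a0 := abs_nonneg (x 0)
    have a1 := abs_nonneg (B1 + (g q).toReal + (γ⁻¹ * (2*C) + B3 + B2) * (‖q‖ + C))
    have a2 := abs_nonneg (-B1 + (g q).toReal - ‖f' q‖ * (‖q‖ + C))
    cases n with
    | zero => linarith
    | succ n =>
      rw [abs_le]
      constructor
      · linarith [hlo (n+1), neg_abs_le (-B1 + (g q).toReal - ‖f' q‖ * (‖q‖ + C))]
      · linarith [hup n, le_abs_self (B1 + (g q).toReal + (γ⁻¹ * (2*C) + B3 + B2) * (‖q‖ + C))]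
  -- key compactness step
  have hkey : ∀ φ : ℕ → ℕ, Tendsto φ atTop atTop →
      Tendsto (fun k => x (φ k) - x (φ k + 1)) atTop (𝓝 0) →
      ∃ ψ : ℕ → ℕ, StrictMono ψ ∧ ∃ p ∈ statPoints f' g,
        Tendsto (fun k => θ (φ (ψ k))) atTop (𝓝 p) ∧
        Tendsto (fun k => x (φ (ψ k))) atTop (𝓝 (Freal f g p)) := by
    intro φ hφ hxφ
    obtain ⟨p, -, ψ, hψ, hp⟩ := (isCompact_closedBall (0:E) C).tendsto_subseq
      (x := fun k => θ (φ k)) (fun k => by simpa using hC (φ k))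
    have hp : Tendsto (fun k => θ (φ (ψ k))) atTop (𝓝 p) := hp
    have hφψ : Tendsto (fun k => φ (ψ k)) atTop atTop := hφ.comp hψ.tendsto_atTop
    have hxφ' : Tendsto (fun k => x (φ (ψ k)) - x (φ (ψ k) + 1)) atTop (𝓝 0) :=
      hxφ.comp hψ.tendsto_atTop
    have hΔ : Tendsto (fun k => θ (φ (ψ k)) - θ (φ (ψ k) + 1)) atTop (𝓝 0) := by
      have h1 : Tendsto (fun k => (2*γ) * (x (φ (ψ k)) - x (φ (ψ k) + 1) + e (φ (ψ k)))) atTop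
          (𝓝 0) := by
        simpa using (hxφ'.add (he.comp hφψ)).const_mul (2*γ)
      have h2 : Tendsto (fun k => ‖θ (φ (ψ k)) - θ (φ (ψ k) + 1)‖^2) atTop (𝓝 0) :=
        squeeze_zero (fun _ => sq_nonneg _) (fun k => hsq _) h1
      have h3 := h2.sqrt
      simp only [Real.sqrt_sq (norm_nonneg _), Real.sqrt_zero] at h3
      exact tendsto_zero_iff_norm_tendsto_zero.2 h3
    have hp1 : Tendsto (fun k => θ (φ (ψ k) + 1)) atTop (𝓝 p) := by
      have := hp.sub hΔ
      simpa using this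
    have hu1 : Tendsto (fun k => u (φ (ψ k))) atTop (𝓝 (-f' p)) := by
      have h1 := ((hΔ.const_smul γ⁻¹).sub (hη1.comp hφψ)).sub ((hf'c.tendsto p).comp hp)
      simpa using h1
    obtain ⟨c1, c2, c3⟩ := hp_closed hb hs.g_ne_top hs.g_lsc hp1 hu1
      (fun k => (hprox _).1) (fun k => (hprox _).2)
    refine ⟨ψ, hψ, p, ⟨c1, c2⟩, hp, ?_⟩
    have h1 : Tendsto (fun k => x (φ (ψ k) + 1)) atTop (𝓝 (Freal f g p)) :=
      ((hfc.tendsto p).comp hp1).add c3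
    have := hxφ'.add h1
    simpa using this
  set S : Set ℝ := {r : ℝ | (r : EReal) ∈ Fval f g '' statPoints f' g} with hSdef
  have hSmem : ∀ p ∈ statPoints f' g, Freal f g p ∈ S := fun p hp =>
    ⟨p, hp, hFr p hp.1⟩
  have hS : ∀ c, c ∉ S → ∃ ε > 0, ∀ᶠ n in atTop, |x n - c| < ε → x (n+1) ≤ x n - ε := by
    intro c hc
    by_contra hcon
    push Not at hcon
    have h1 : ∀ k : ℕ, ∃ n ≥ k, |x n - c| < 1/((k:ℝ)+1) ∧ x n - 1/((k:ℝ)+1) < x (n+1) := by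
      intro k
      obtain ⟨n, hn, hn'⟩ := frequently_atTop.1 (hcon (1/((k:ℝ)+1)) (by positivity)) k
      exact ⟨n, hn, hn'⟩
    choose φ hφ1 hφ2 hφ3 using h1
    have hφ : Tendsto φ atTop atTop := tendsto_atTop_mono hφ1 tendsto_id
    have h0 := tendsto_one_div_add_atTop_nhds_zero_nat (𝕜 := ℝ)
    have hd : Tendsto (fun k => x (φ k) - x (φ k + 1)) atTop (𝓝 0) := by
      have hl : Tendsto (fun k => - e (φ k)) atTop (𝓝 0) := by
        simpa using (he.comp hφ).neg
      refine tendsto_of_tendsto_of_tendsto_of_le_of_le hl h0 ?_ ?_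
      · intro k; have := hstep (φ k); simp only; linarith
      · intro k; have := hφ3 k; simp only; linarith
    obtain ⟨ψ, hψ, p, hp, -, hp2⟩ := hkey φ hφ hd
    have hxc : Tendsto (fun k => x (φ k)) atTop (𝓝 c) := by
      rw [tendsto_iff_dist_tendsto_zero]
      exact squeeze_zero (fun _ => dist_nonneg) (fun k => (hφ2 k).le) h0
    have := tendsto_nhds_unique (hxc.comp hψ.tendsto_atTop) hp2
    exact hc (this ▸ hSmem p hp)
  obtain ⟨a, b, hab, hIcc, hev⟩ := hp_real_seq x e S hbx he hstep hS
  have hFx : (fun n => Fval f g (θ n)) = fun n => ((x n : ℝ) : EReal) :=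
    funext fun n => hFr _ (hfin n)
  rw [hFx]
  constructor
  · refine ⟨(a : EReal), hIcc (Set.left_mem_Icc.2 hab), ?_⟩
    intro y hy
    have hy1 : ∀ τ > 0, y ∈ Set.Icc ((a - τ : ℝ) : EReal) ((b + τ : ℝ) : EReal) := by
      intro τ hτ
      have hcl : IsClosed (Set.Icc ((a - τ : ℝ) : EReal) ((b + τ : ℝ) : EReal)) := isClosed_Icc
      by_contra hny
      have h1 := hy.frequently (hcl.isOpen_compl.mem_nhds hny)
      obtain ⟨n, hn, hn'⟩ := (h1.and_eventually (hev τ hτ)).exists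
      exact hn ⟨by exact_mod_cast hn'.1.le, by exact_mod_cast hn'.2.le⟩
    have hyb : y ≠ ⊥ := fun h => by
      have := (hy1 1 one_pos).1
      rw [h, le_bot_iff] at this
      exact EReal.coe_ne_bot _ this
    have hyt : y ≠ ⊤ := fun h => by
      have := (hy1 1 one_pos).2
      rw [h, top_le_iff] at this
      exact EReal.coe_ne_top _ this
    lift y to ℝ using ⟨hyt, hyb⟩
    have hyI : y ∈ Set.Icc a b := by
      constructor
      · refine le_of_forall_pos_le_add fun τ hτ => ?_
        have := (hy1 τ hτ).1
        have : a - τ ≤ y := by exact_mod_cast this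
        linarith
      · refine le_of_forall_pos_le_add fun τ hτ => ?_
        exact_mod_cast (hy1 τ hτ).2
    have hpre : IsPreconnected ((fun r : ℝ => (r : EReal)) '' Set.Icc a b) :=
      isPreconnected_Icc.image _ continuous_coe_real_ereal.continuousOn
    refine hpre.subset_connectedComponentIn ⟨a, Set.left_mem_Icc.2 hab, rfl⟩ ?_ ⟨y, hyI, rfl⟩
    rintro _ ⟨r, hr, rfl⟩
    exact hIcc hr
  · intro hint
    have hab' : a = b := by
      by_contra hne
      have hlt := lt_of_le_of_ne hab hne
      obtain ⟨m, hm⟩ := Set.nonempty_Ioo.2 hlt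
      have : m ∈ interior S :=
        interior_maximal (Set.Ioo_subset_Icc_self.trans hIcc) isOpen_Ioo hm
      rw [hint] at this
      exact this
    subst hab'
    have hxa : Tendsto x atTop (𝓝 a) := by
      rw [tendsto_order]
      constructor
      · intro c hc
        filter_upwards [hev (a - c) (by linarith)] with n hn
        linarith [hn.1]
      · intro c hc
        filter_upwards [hev (c - a) (by linarith)] with n hn
        linarith [hn.2]
    obtain ⟨θs, hθs, hθa⟩ := hIcc (Set.left_mem_Icc.2 le_rfl)
    refine ⟨θs, hθs, ?_, ?_⟩
    · rw [hθa]
      exact (continuous_coe_real_ereal.tendsto a).comp hxa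
    · apply tendsto_of_subseq_tendsto
      intro φ hφ
      have hd : Tendsto (fun k => x (φ k) - x (φ k + 1)) atTop (𝓝 0) := by
        have := (hxa.comp hφ).sub ((hxa.comp (tendsto_add_atTop_nat 1)).comp hφ)
        simpa using this
      obtain ⟨ψ, hψ, p, hp, hp1, hp2⟩ := hkey φ hφ hd
      refine ⟨ψ, ?_⟩
      have hpa : Freal f g p = a :=
        tendsto_nhds_unique hp2 ((hxa.comp hφ).comp hψ.tendsto_atTop)
      have hpm : p ∈ statPoints f' g ∩ {v : E | Fval f g v = Fval f g θs} := by
        refine ⟨hp, ?_⟩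
        change Fval f g p = Fval f g θs
        rw [hθa, hFr p hp.1, hpa]
      refine squeeze_zero (fun _ => Metric.infDist_nonneg)
        (fun k => Metric.infDist_le_dist_of_mem hpm) ?_
      exact tendsto_iff_dist_tendsto_zero.1 hp1
end

section
/- Assume additionally that f is convex and argmin_Θ F is nonempty, and let (θ_n)_{n≥0} be the perturbed proximal gradient sequence with step sizes γ_n ∈ (0, 1/L] for all n ≥ 1. Suppose that for every θ⋆ ∈ 𝓛 the series Σ_{n≥0} γ_{n+1} ⟨T_{γ_{n+1}}(θ_n) − θ⋆, η_{n+1}⟩ converges in ℝ, and that Σ_{n≥0} γ_{n+1}² ‖η_{n+1}‖² < ∞. Then for every θ⋆ ∈ 𝓛 the limit lim_n ‖θ_n − θ⋆‖ exists. If in addition Σ_n γ_n = +∞, then there exists θ_∞ ∈ 𝓛 such that lim_n θ_n = θ_∞. -/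
open Filter MeasureTheory Finset
open scoped InnerProductSpace Topology

lemma small_t {a b c : ℝ} (h : ∀ t : ℝ, 0 < t → t ≤ 1 → a ≤ b + t * c) : a ≤ b := by
  have h1 : Tendsto (fun t : ℝ => b + t * c) (𝓝[>] 0) (𝓝 (b + 0 * c)) := by
    apply Tendsto.mono_left _ nhdsWithin_le_nhds
    exact Continuous.tendsto (by fun_prop) 0
  have h2 : ∀ᶠ t in 𝓝[>] (0:ℝ), a ≤ b + t * c := by
    filter_upwards [Ioc_mem_nhdsGT (show (0:ℝ) < 1 by norm_num)] with t ht
    exact h t ht.1 ht.2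
  simpa using ge_of_tendsto h1 h2

section aux
variable {E : Type*} [NormedAddCommGroup E] [InnerProductSpace ℝ E]

lemma descent [CompleteSpace E] {f : E → ℝ} {f' : E → E} {L : ℝ}
    (hf : ∀ x, HasGradientAt f (f' x) x)
    (lip : ∀ x y, ‖f' x - f' y‖ ≤ L * ‖x - y‖) (x d : E) :
    f (x + d) ≤ f x + ⟪f' x, d⟫_ℝ + L / 2 * ‖d‖ ^ 2 := by
  let φ : ℝ → ℝ := fun t => f (x + t • d) - t * ⟪f' x, d⟫_ℝ - L / 2 * t ^ 2 * ‖d‖ ^ 2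
  have hd : ∀ t, HasDerivAt φ (⟪f' (x + t • d), d⟫_ℝ - ⟪f' x, d⟫_ℝ - L * t * ‖d‖ ^ 2) t := by
    intro t
    have h1 : HasDerivAt (fun t : ℝ => x + t • d) d t := by
      simpa using ((hasDerivAt_id t).smul_const d).const_add x
    have h2 : HasDerivAt (fun t : ℝ => f (x + t • d)) (⟪f' (x + t • d), d⟫_ℝ) t := by
      have := (hf (x + t • d)).hasFDerivAt.comp_hasDerivAt t h1
      simpa [Function.comp_def] using this
    have h3 : HasDerivAt (fun t : ℝ => t * ⟪f' x, d⟫_ℝ) (⟪f' x, d⟫_ℝ) t := by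
      simpa using (hasDerivAt_id t).mul_const (⟪f' x, d⟫_ℝ)
    have h4 : HasDerivAt (fun t : ℝ => L / 2 * t ^ 2 * ‖d‖ ^ 2) (L * t * ‖d‖ ^ 2) t := by
      have := (((hasDerivAt_id t).pow 2).const_mul (L / 2)).mul_const (‖d‖ ^ 2)
      refine this.congr_deriv ?_
      simp only [id]; push_cast; ring
    exact (h2.sub h3).sub h4
  have hanti : AntitoneOn φ (Set.Icc 0 1) := by
    apply antitoneOn_of_deriv_nonpos (convex_Icc 0 1)
    · exact fun t _ => (hd t).continuousAt.continuousWithinAt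
    · exact fun t _ => (hd t).differentiableAt.differentiableWithinAt
    · intro t ht
      rw [interior_Icc] at ht
      rw [(hd t).deriv, ← inner_sub_left]
      have h1 := real_inner_le_norm (f' (x + t • d) - f' x) d
      have h2 := lip (x + t • d) x
      rw [add_sub_cancel_left, norm_smul, Real.norm_of_nonneg ht.1.le] at h2
      have h3 := mul_le_mul_of_nonneg_right h2 (norm_nonneg d)
      nlinarith
  have := hanti (Set.left_mem_Icc.2 zero_le_one) (Set.right_mem_Icc.2 zero_le_one) zero_le_one
  simp [φ] at this
  linarith

lemma grad_ineq [CompleteSpace E] {f : E → ℝ} {f' : E → E} {L : ℝ}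
    (hf : ∀ x, HasGradientAt f (f' x) x)
    (lip : ∀ x y, ‖f' x - f' y‖ ≤ L * ‖x - y‖) (hc : ConvexOn ℝ Set.univ f) (x y : E) :
    f x + ⟪f' x, y - x⟫_ℝ ≤ f y := by
  apply small_t (c := L / 2 * ‖y - x‖ ^ 2)
  intro t ht ht1
  have hf2 : ∀ x, HasGradientAt (fun x => - f x) (- f' x) x := by
    intro x
    rw [hasGradientAt_iff_hasFDerivAt, map_neg]
    exact (hf x).hasFDerivAt.neg
  have h1 := descent (f := fun x => - f x) (f' := fun x => - f' x) (L := L) hf2 (by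
    intro x y
    rw [← neg_sub', norm_neg]; exact lip x y) x (t • (y - x))
  have h2 := hc.2 (Set.mem_univ x) (Set.mem_univ y) (show 0 ≤ 1 - t by linarith) ht.le (by ring)
  have h3 : (1 - t) • x + t • y = x + t • (y - x) := by module
  rw [h3] at h2
  simp only [inner_neg_left, inner_smul_right, norm_smul, smul_eq_mul,
    Real.norm_of_nonneg ht.le] at h1 h2
  have h4 : 0 ≤ t * (f y + t * (L / 2 * ‖y - x‖ ^ 2) - (f x + ⟪f' x, y - x⟫_ℝ)) := by
    nlinarith
  have := nonneg_of_mul_nonneg_right h4 ht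
  linarith

lemma var_ineq {g : E → EReal} (hb : ∀ x, g x ≠ ⊥) (hc : ERealConvexOn g)
    {h : E → ℝ} {p w : E} {C : ℝ} (hp : g p ≠ ⊤)
    (hmin : ∀ y, g p + (h p : EReal) ≤ g y + (h y : EReal))
    (hq : ∀ d, h (p + d) ≤ h p + ⟪w, d⟫_ℝ + C * ‖d‖ ^ 2) {v : E} (hv : g v ≠ ⊤) :
    (g p).toReal ≤ (g v).toReal + ⟪w, v - p⟫_ℝ := by
  apply small_t (c := C * ‖v - p‖ ^ 2)
  intro t ht ht1
  have h2 := hc p v (1 - t) t (by linarith) ht.le (by ring)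
  have h3 : (1 - t) • p + t • v = p + t • (v - p) := by module
  have h1 := hmin (p + t • (v - p))
  have h5 := hq (t • (v - p))
  rw [h3] at h2
  have ep := EReal.coe_toReal hp (hb p)
  have ev := EReal.coe_toReal hv (hb v)
  set P := (g p).toReal
  set V := (g v).toReal
  rw [← ep, ← ev] at h2
  rw [← ep] at h1
  have h6 : ((P + h p : ℝ) : EReal) ≤ (((1 - t) * P + t * V + h (p + t • (v - p)) : ℝ) : EReal) := by
    push_cast
    refine h1.trans ?_
    gcongr
    simpa using h2
  rw [EReal.coe_le_coe_iff] at h6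
  simp only [inner_smul_right, norm_smul, Real.norm_of_nonneg ht.le] at h5
  have h4 : 0 ≤ t * (V + ⟪w, v - p⟫_ℝ + t * (C * ‖v - p‖ ^ 2) - P) := by
    nlinarith
  have := nonneg_of_mul_nonneg_right h4 ht
  linarith

variable [CompleteSpace E] {f : E → ℝ} {f' : E → E} {g : E → EReal} {L : ℝ}
  {prox : ℝ → E → E}

lemma prox_ne_top (hs : ProxSetting f f' g L prox) {γ : ℝ} (hγ : 0 < γ) (x : E) :
    g (prox γ x) ≠ ⊤ := by
  obtain ⟨v, hv⟩ := hs.g_ne_top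
  intro h
  have h1 := hs.prox_spec γ hγ x v
  rw [h, EReal.top_add_coe, top_le_iff, ← EReal.coe_toReal hv (hs.g_ne_bot v),
    ← EReal.coe_add] at h1
  exact EReal.coe_ne_top _ h1

lemma prox_ineq (hs : ProxSetting f f' g L prox) {γ : ℝ} (hγ : 0 < γ) (x : E) {v : E}
    (hv : g v ≠ ⊤) :
    γ * (g (prox γ x)).toReal + ⟪x - prox γ x, v - prox γ x⟫_ℝ ≤ γ * (g v).toReal := by
  have := var_ineq hs.g_ne_bot hs.g_conv (h := fun y => ‖y - x‖ ^ 2 / (2 * γ))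
    (w := γ⁻¹ • (prox γ x - x)) (C := 1 / (2 * γ)) (prox_ne_top hs hγ x) (hs.prox_spec γ hγ x)
    (by
      intro d
      apply le_of_eq
      rw [add_sub_right_comm, norm_add_sq_real, inner_smul_left]
      simp
      field_simp) hv
  have h2 := mul_le_mul_of_nonneg_left this hγ.le
  rw [inner_smul_left] at h2
  simp only [mul_add, conj_trivial, mul_inv_cancel_left₀ hγ.ne'] at h2
  rw [← neg_sub x, inner_neg_left] at h2
  linarith

lemma argmin_stat (hs : ProxSetting f f' g L prox) {m : E}
    (hm : ∀ v : E, Fval f g m ≤ Fval f g v) : m ∈ statPoints f' g := by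
  have hmt : g m ≠ ⊤ := by
    obtain ⟨v, hv⟩ := hs.g_ne_top
    intro h
    have h1 := hm v
    rw [Fval, Fval, h, EReal.coe_add_top, top_le_iff, ← EReal.coe_toReal hv (hs.g_ne_bot v),
      ← EReal.coe_add] at h1
    exact EReal.coe_ne_top _ h1
  refine ⟨hmt, fun v => ?_⟩
  by_cases hv : g v = ⊤
  · rw [hv]; exact le_top
  have := var_ineq hs.g_ne_bot hs.g_conv (h := f) (w := f' m) (C := L / 2) hmt
    (fun y => by simpa [Fval, add_comm] using hm y)
    (fun d => descent hs.f_grad hs.lip m d) hv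
  rw [← EReal.coe_toReal hv (hs.g_ne_bot v), ← EReal.coe_toReal hmt (hs.g_ne_bot m),
    ← EReal.coe_add, EReal.coe_le_coe_iff, inner_neg_left]
  linarith

lemma stat_min (hs : ProxSetting f f' g L prox) (hc : ConvexOn ℝ Set.univ f) {m : E}
    (hm : m ∈ statPoints f' g) {v : E} (hv : g v ≠ ⊤) : Freal f g m ≤ Freal f g v := by
  have h1 := hm.2 v
  rw [← EReal.coe_toReal hv (hs.g_ne_bot v), ← EReal.coe_toReal hm.1 (hs.g_ne_bot m),
    ← EReal.coe_add, EReal.coe_le_coe_iff, inner_neg_left] at h1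
  have h2 := grad_ineq hs.f_grad hs.lip hc m v
  unfold Freal
  linarith

lemma step_ineq (hs : ProxSetting f f' g L prox) (hc : ConvexOn ℝ Set.univ f) {m : E}
    (hm : g m ≠ ⊤) {γ : ℝ} (hγ : 0 < γ) (hγL : γ ≤ 1 / L) (u e : E) :
    ‖prox γ (u - γ • (f' u + e)) - m‖ ^ 2 ≤ ‖u - m‖ ^ 2
      - 2 * γ * (Freal f g (prox γ (u - γ • (f' u + e))) - Freal f g m)
      + (-2 * (γ * ⟪Tmap prox f' γ u - m, e⟫_ℝ) + 2 * (γ ^ 2 * ‖e‖ ^ 2)) := by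
  unfold Tmap Freal
  have hq := prox_ne_top hs hγ (u - γ • (f' u + e))
  have hp := prox_ne_top hs hγ (u - γ • f' u)
  have i1 := prox_ineq hs hγ (u - γ • (f' u + e)) hm
  have i2 := prox_ineq hs hγ (u - γ • (f' u + e)) hp
  have i3 := prox_ineq hs hγ (u - γ • f' u) hq
  set q := prox γ (u - γ • (f' u + e))
  set p := prox γ (u - γ • f' u)
  have d1 := descent hs.f_grad hs.lip u (q - u)
  have d2 := grad_ineq hs.f_grad hs.lip hc u m
  rw [add_sub_cancel] at d1
  -- nonexpansiveness
  have n1 : ‖q - p‖ ^ 2 ≤ - (γ * ⟪e, q - p⟫_ℝ) := by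
    have e1 : ⟪u - γ • (f' u + e) - q, p - q⟫_ℝ + ⟪u - γ • f' u - p, q - p⟫_ℝ
        = ‖q - p‖ ^ 2 + γ * ⟪e, q - p⟫_ℝ := by
      have : u - γ • (f' u + e) - q = (u - γ • f' u - p) - (q - p) - γ • e := by module
      rw [this, ← neg_sub q p, inner_neg_right, inner_sub_left, inner_sub_left,
        real_inner_self_eq_norm_sq, real_inner_smul_left]
      ring
    linarith
  have n2 : - (γ * ⟪e, q - p⟫_ℝ) ≤ γ ^ 2 * ‖e‖ ^ 2 := by
    have c1 := abs_real_inner_le_norm e (q - p)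
    have c2 := neg_le_of_abs_le c1
    have c3 := mul_le_mul_of_nonneg_left c2 hγ.le
    nlinarith [sq_nonneg (γ * ‖e‖ - ‖q - p‖)]
  have e2 : ⟪q - m, e⟫_ℝ = ⟪p - m, e⟫_ℝ + ⟪e, q - p⟫_ℝ := by
    rw [real_inner_comm (q - p) e, ← inner_add_left]; congr 1; abel
  have e3 : ⟪u - γ • (f' u + e) - q, m - q⟫_ℝ
      = ⟪u - q, m - q⟫_ℝ + γ * ⟪f' u, q - m⟫_ℝ + γ * ⟪q - m, e⟫_ℝ := by
    rw [real_inner_comm e (q - m), ← neg_sub q m, inner_neg_right, inner_neg_right,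
      sub_right_comm, inner_sub_left,
      real_inner_smul_left, inner_add_left]
    ring
  have e4 : ‖u - m‖ ^ 2 = ‖u - q‖ ^ 2 - 2 * ⟪u - q, m - q⟫_ℝ + ‖q - m‖ ^ 2 := by
    rw [norm_sub_rev q m, ← norm_sub_sq_real]; congr 2; abel
  have e5 : ⟪f' u, q - u⟫_ℝ - ⟪f' u, m - u⟫_ℝ = ⟪f' u, q - m⟫_ℝ := by
    rw [← inner_sub_right]; congr 1; abel
  have hL : γ * L ≤ 1 := by
    rwa [le_div_iff₀ hs.L_pos] at hγL
  have d3 : γ * f q ≤ γ * f m + γ * ⟪f' u, q - m⟫_ℝ + 1 / 2 * ‖u - q‖ ^ 2 := by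
    have : f q ≤ f m + ⟪f' u, q - m⟫_ℝ + L / 2 * ‖u - q‖ ^ 2 := by
      rw [norm_sub_rev u q]; linarith
    have := mul_le_mul_of_nonneg_left this hγ.le
    have := mul_le_mul_of_nonneg_right hL (sq_nonneg ‖u - q‖)
    nlinarith
  rw [e3] at i1
  rw [e2] at i1
  linarith

lemma lsc_stat (hs : ProxSetting f f' g L prox) (hc : ConvexOn ℝ Set.univ f) {m : E}
    (hm : m ∈ statPoints f' g) {x : ℕ → E} {a : E} (hx : Tendsto x atTop (𝓝 a))
    (hxt : ∀ n, g (x n) ≠ ⊤) {ε : ℕ → ℝ} (hε : Tendsto ε atTop (𝓝 0))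
    (hF : ∀ n, Freal f g (x n) ≤ Freal f g m + ε n) : a ∈ statPoints f' g := by
  have hga : g a ≤ ((Freal f g m - f a : ℝ) : EReal) := by
    rw [← EReal.ge_of_forall_gt_iff_ge]
    intro c hcg
    rw [EReal.coe_le_coe_iff]
    have h1 : ∀ᶠ n in atTop, (c : EReal) < g (x n) := hx.eventually (hs.g_lsc a _ hcg)
    have h2 : Tendsto (fun n => Freal f g m + ε n - f (x n)) atTop
        (𝓝 (Freal f g m + 0 - f a)) :=
      (tendsto_const_nhds.add hε).sub ((hs.f_grad a).continuousAt.tendsto.comp hx)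
    rw [add_zero] at h2
    apply ge_of_tendsto h2
    filter_upwards [h1] with n hn
    rw [← EReal.coe_toReal (hxt n) (hs.g_ne_bot _), EReal.coe_lt_coe_iff] at hn
    have := hF n
    unfold Freal at this ⊢
    linarith
  have hat : g a ≠ ⊤ := ne_top_of_le_ne_top (EReal.coe_ne_top _) hga
  apply argmin_stat hs
  intro v
  by_cases hv : g v = ⊤
  · simp [Fval, hv]
  have h3 := stat_min hs hc hm hv
  rw [← EReal.coe_toReal hat (hs.g_ne_bot a), EReal.coe_le_coe_iff] at hga
  rw [Fval, Fval, ← EReal.coe_toReal hv (hs.g_ne_bot v), ← EReal.coe_toReal hat (hs.g_ne_bot a),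
    ← EReal.coe_add, ← EReal.coe_add, EReal.coe_le_coe_iff]
  unfold Freal at h3 hga
  linarith

end aux

lemma robbins {a b e : ℕ → ℝ} (ha : ∀ n, 0 ≤ a n) (hb : ∀ n, 0 ≤ b n)
    (h : ∀ n, a (n + 1) ≤ a n - b n + e n) {s : ℝ}
    (he : Tendsto (fun N => ∑ k ∈ Finset.range N, e k) atTop (𝓝 s)) :
    (∃ l, Tendsto a atTop (𝓝 l)) ∧ ∃ B, ∀ N, ∑ k ∈ Finset.range N, b k ≤ B := by
  obtain ⟨M, hM⟩ := he.bddAbove_range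
  have hM' : ∀ N, ∑ k ∈ Finset.range N, e k ≤ M := fun N => hM ⟨N, rfl⟩
  constructor
  · let c : ℕ → ℝ := fun n => a n - ∑ k ∈ Finset.range n, e k
    have hc : Antitone c := by
      apply antitone_nat_of_succ_le
      intro n
      simp only [c, Finset.sum_range_succ]
      linarith [h n, hb n]
    have hbd : BddBelow (Set.range c) := by
      refine ⟨-M, ?_⟩
      rintro _ ⟨n, rfl⟩
      simp only [c]
      linarith [ha n, hM' n]
    have := (tendsto_atTop_ciInf hc hbd).add he
    refine ⟨_, this.congr fun n => ?_⟩
    simp [c]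
  · refine ⟨a 0 + M, fun N => ?_⟩
    have : ∀ N, a N + ∑ k ∈ Finset.range N, b k ≤ a 0 + ∑ k ∈ Finset.range N, e k := by
      intro N
      induction N with
      | zero => simp
      | succ n ih =>
        simp only [Finset.sum_range_succ]
        linarith [h n]
    linarith [this N, ha N, hM' N]

lemma freq_small {γ b : ℕ → ℝ} (hγ : ∀ n, 0 < γ (n + 1)) {B : ℝ} 
    (hb : ∀ n, 0 ≤ b n)
    (hB : ∀ N, ∑ k ∈ Finset.range N, 2 * γ (k + 1) * b (k + 1) ≤ B)
    (hdiv : Tendsto (fun N => ∑ k ∈ Finset.range N, γ k) atTop atTop) {ε : ℝ} (hε : 0 < ε) :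
    ∃ᶠ k in atTop, b (k + 1) ≤ ε := by
  by_contra hcon
  rw [Filter.not_frequently] at hcon
  obtain ⟨N, hN⟩ := eventually_atTop.1 hcon
  push Not at hN
  have key : ∀ n, ∑ k ∈ Finset.range n, γ (k + 1)
      ≤ ∑ k ∈ Finset.range N, γ (k + 1) + B / (2 * ε) := by
    intro n
    have h1 : ∑ k ∈ Finset.range n, γ (k + 1) ≤ ∑ k ∈ Finset.range (N + n), γ (k + 1) := by
      apply Finset.sum_le_sum_of_subset_of_nonneg
      · apply Finset.range_mono; omega
      · intro i _ _; exact (hγ i).le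
    rw [Finset.sum_range_add] at h1
    have h2 := hB (N + n)
    rw [Finset.sum_range_add] at h2
    have h3 : 0 ≤ ∑ k ∈ Finset.range N, 2 * γ (k + 1) * b (k + 1) :=
      Finset.sum_nonneg fun i _ => mul_nonneg (by linarith [hγ i]) (hb _)
    have h4 : (2 * ε) * ∑ k ∈ Finset.range n, γ (N + k + 1)
        ≤ ∑ k ∈ Finset.range n, 2 * γ (N + k + 1) * b (N + k + 1) := by
      rw [Finset.mul_sum]
      apply Finset.sum_le_sum
      intro i _
      have := mul_le_mul_of_nonneg_left (hN (N + i) (by omega)).le (hγ (N + i)).le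
      linarith
    have h5 : ∑ k ∈ Finset.range n, γ (N + k + 1) ≤ B / (2 * ε) := by
      rw [le_div_iff₀ (by linarith)]; linarith
    linarith
  have h6 := (tendsto_add_atTop_iff_nat 1).2 hdiv
  obtain ⟨n, hn⟩ := (h6.eventually_gt_atTop
    (∑ k ∈ Finset.range N, γ (k + 1) + B / (2 * ε) + γ 0)).exists
  rw [Finset.sum_range_succ'] at hn
  linarith [key n]

/-- **Theorem 3.2 (ii)** (convergence of the perturbed proximal gradient). -/
theorem stmt4
    {E : Type*} [NormedAddCommGroup E] [InnerProductSpace ℝ E] [FiniteDimensional ℝ E]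
    (f : E → ℝ) (f' : E → E) (g : E → EReal) (L : ℝ) (prox : ℝ → E → E)
    (hs : ProxSetting f f' g L prox)
    (hfconv : ConvexOn ℝ Set.univ f)
    (hargmin : ∃ m : E, ∀ v : E, Fval f g m ≤ Fval f g v)
    (γ : ℕ → ℝ) (hγ : ∀ n : ℕ, 1 ≤ n → 0 < γ n ∧ γ n ≤ 1 / L)
    (θ H η : ℕ → E) (hθ0 : g (θ 0) ≠ ⊤)
    (hrec : ∀ n : ℕ, θ (n + 1) = prox (γ (n + 1)) (θ n - γ (n + 1) • H (n + 1)))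
    (hη : ∀ n : ℕ, η (n + 1) = H (n + 1) - f' (θ n))
    (hser : ∀ θs ∈ statPoints f' g, ∃ s : ℝ,
      Tendsto
        (fun N => ∑ k ∈ Finset.range N,
          γ (k + 1) * ⟪Tmap prox f' (γ (k + 1)) (θ k) - θs, η (k + 1)⟫_ℝ)
        atTop (nhds s))
    (hsq : Summable fun n => γ (n + 1) ^ 2 * ‖η (n + 1)‖ ^ 2) :
    (∀ θs ∈ statPoints f' g, ∃ l : ℝ, Tendsto (fun n => ‖θ n - θs‖) atTop (nhds l)) ∧
      (Tendsto (fun N => ∑ k ∈ Finset.range N, γ k) atTop atTop →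
        ∃ θi ∈ statPoints f' g, Tendsto θ atTop (nhds θi)) := by
  have : CompleteSpace E := FiniteDimensional.complete ℝ E
  have hrec' : ∀ n, θ (n + 1) = prox (γ (n + 1)) (θ n - γ (n + 1) • (f' (θ n) + η (n + 1))) := by
    intro n; rw [hη, add_sub_cancel]; exact hrec n
  have hγ0 : ∀ n, 0 < γ (n + 1) := fun n => (hγ (n + 1) (by omega)).1
  have htop : ∀ n, g (θ n) ≠ ⊤ := by
    intro n
    cases n with
    | zero => exact hθ0
    | succ n => rw [hrec]; exact prox_ne_top hs (hγ0 n) _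
  have hrob : ∀ m ∈ statPoints f' g, (∃ l, Tendsto (fun n => ‖θ n - m‖ ^ 2) atTop (𝓝 l)) ∧
      ∃ B, ∀ N, ∑ k ∈ Finset.range N, 2 * γ (k + 1) * (Freal f g (θ (k + 1)) - Freal f g m) ≤ B := by
    intro m hm
    obtain ⟨s, hs1⟩ := hser m hm
    have hs2 := hsq.hasSum.tendsto_sum_nat
    refine robbins (e := fun n => -2 * (γ (n + 1) * ⟪Tmap prox f' (γ (n + 1)) (θ n) - m, η (n + 1)⟫_ℝ)
      + 2 * (γ (n + 1) ^ 2 * ‖η (n + 1)‖ ^ 2))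
      (s := -2 * s + 2 * ∑' n, γ (n + 1) ^ 2 * ‖η (n + 1)‖ ^ 2) ?_ ?_ ?_ ?_
    · intro n; positivity
    · intro n
      exact mul_nonneg (by linarith [hγ0 n]) (sub_nonneg.2 (stat_min hs hfconv hm (htop _)))
    · intro n
      have := step_ineq hs hfconv hm.1 (hγ0 n) (hγ (n + 1) (by omega)).2 (θ n) (η (n + 1))
      rw [← hrec' n] at this
      exact this
    · have := (hs1.const_mul (-2)).add (hs2.const_mul 2)
      refine this.congr fun N => ?_
      rw [Finset.sum_add_distrib, Finset.mul_sum, Finset.mul_sum]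
  have hlim : ∀ m ∈ statPoints f' g, ∃ l : ℝ, Tendsto (fun n => ‖θ n - m‖) atTop (𝓝 l) := by
    intro m hm
    obtain ⟨l, hl⟩ := (hrob m hm).1
    refine ⟨√l, hl.sqrt.congr fun n => ?_⟩
    exact Real.sqrt_sq (norm_nonneg _)
  refine ⟨hlim, fun hdiv => ?_⟩
  obtain ⟨m, hm⟩ := hargmin
  replace hm := argmin_stat hs hm
  obtain ⟨B, hB⟩ := (hrob m hm).2
  have hfreq : ∀ n : ℕ, ∃ᶠ k in atTop,
      Freal f g (θ (k + 1)) - Freal f g m ≤ 1 / ((n : ℝ) + 1) := fun n =>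
    freq_small (b := fun k => Freal f g (θ k) - Freal f g m) hγ0
      (fun n => sub_nonneg.2 (stat_min hs hfconv hm (htop _))) hB hdiv (by positivity)
  obtain ⟨φ, hφ, hφ2⟩ := extraction_forall_of_frequently hfreq
  obtain ⟨l, hl⟩ := hlim m hm
  obtain ⟨R, hR⟩ := hl.bddAbove_range
  obtain ⟨a, -, ψ, hψ, ha⟩ := tendsto_subseq_of_bounded (x := fun n => θ (φ n + 1))
    (s := Metric.closedBall m R) Metric.isBounded_closedBall (fun n => by
      rw [mem_closedBall_iff_norm]; exact hR ⟨_, rfl⟩)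
  have hast : a ∈ statPoints f' g := by
    refine lsc_stat hs hfconv hm ha (fun n => htop _)
      (ε := fun n => 1 / ((ψ n : ℝ) + 1)) ?_ ?_
    · exact tendsto_one_div_add_atTop_nhds_zero_nat.comp hψ.tendsto_atTop
    · intro n
      have := hφ2 (ψ n)
      simp only [Function.comp]
      linarith
  refine ⟨a, hast, ?_⟩
  obtain ⟨r, hr⟩ := hlim a hast
  have hsub : Tendsto (fun n => φ (ψ n) + 1) atTop atTop :=
    (tendsto_add_atTop_nat 1).comp (hφ.tendsto_atTop.comp hψ.tendsto_atTop)
  have h1 := hr.comp hsub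
  have h2 := tendsto_iff_norm_sub_tendsto_zero.1 ha
  have : r = 0 := tendsto_nhds_unique h1 h2
  rw [this] at hr
  exact tendsto_iff_norm_sub_tendsto_zero.2 hr
end

section
/- Assume additionally that f is convex and argmin_Θ F is nonempty. Let (θ_n)_{n≥0} be the random perturbed proximal gradient sequence with step sizes γ_n ∈ (0, 1/L] for all n ≥ 1, let (a_n)_{n≥1} be nonnegative weights with A_n = Σ_{k=1}^n a_k > 0 and with (a_n/γ_n)_{n≥1} nondecreasing, and suppose there is a constant B with ℙ(sup_n ‖θ_n‖ ≤ B) = 1. Then for every minimizer θ⋆ of F and every n ≥ 1: (1/A_n) Σ_{k=1}^n a_k E[F(θ_k)] − F(θ⋆) ≤ B⋆² a_n/(2 γ_n A_n) + (1/A_n) Σ_{k=1}^n a_k { B⋆ E[ε_{k−1}^{(1)}] + γ_k E[ε_{k−1}^{(2)}] }, where B⋆ = B + ‖θ⋆‖. -/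
open Filter MeasureTheory Finset
open scoped InnerProductSpace Topology

section Aux

variable {E : Type*} [NormedAddCommGroup E] [InnerProductSpace ℝ E] [CompleteSpace E]
  {f : E → ℝ} {f' : E → E} {g : E → EReal} {L : ℝ} {prox : ℝ → E → E}

lemma aux_prox_ne_top (hs : ProxSetting f f' g L prox) {γ : ℝ} (hγ : 0 < γ) (u : E) :
    g (prox γ u) ≠ ⊤ := by
  intro h
  obtain ⟨v, hv⟩ := hs.g_ne_top
  have := hs.prox_spec γ hγ u v
  rw [h] at this
  rw [EReal.top_add_coe, top_le_iff] at this
  lift g v to ℝ using ⟨hv, hs.g_ne_bot v⟩ with r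
  exact absurd this (by rw [← EReal.coe_add]; exact EReal.coe_ne_top _)

lemma aux_prox_ineq (hs : ProxSetting f f' g L prox) {γ : ℝ} (hγ : 0 < γ) (u v : E)
    (hv : g v ≠ ⊤) :
    γ * ((g (prox γ u)).toReal - (g v).toReal) ≤ ⟪prox γ u - u, v - prox γ u⟫_ℝ := by
  set p := prox γ u with hp
  have hpt : g p ≠ ⊤ := aux_prox_ne_top hs hγ u
  have key : ∀ t : ℝ, 0 < t → t < 1 → γ * ((g p).toReal - (g v).toReal) ≤
      ⟪p - u, v - p⟫_ℝ + t * (‖v - p‖ ^ 2 / 2) := by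
    intro t ht ht1
    have h1 := hs.g_conv p v (1 - t) t (by linarith) ht.le (by ring)
    have h2 := hs.prox_spec γ hγ u ((1 - t) • p + t • v)
    rw [← hp] at h2
    have hw : ‖(1 - t) • p + t • v - u‖ ^ 2
        = ‖p - u‖ ^ 2 + 2 * t * ⟪p - u, v - p⟫_ℝ + t ^ 2 * ‖v - p‖ ^ 2 := by
      have : (1 - t) • p + t • v - u = (p - u) + t • (v - p) := by module
      rw [this, norm_add_sq_real, inner_smul_right, norm_smul, mul_pow, Real.norm_eq_abs, sq_abs]
      ring
    rw [hw] at h2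
    generalize hgp : g p = gp at *
    generalize hgv : g v = gv at *
    lift gp to ℝ using ⟨hpt, hgp ▸ hs.g_ne_bot p⟩
    lift gv to ℝ using ⟨hv, hgv ▸ hs.g_ne_bot v⟩
    have h3 := h2.trans (add_le_add_left h1 _)
    norm_cast at h3
    simp only [EReal.toReal_coe]
    have h4 : t * (gp - gv) ≤ (2 * t * ⟪p - u, v - p⟫_ℝ + t ^ 2 * ‖v - p‖ ^ 2) / (2 * γ) := by
      have : (‖p - u‖ ^ 2 + 2 * t * ⟪p - u, v - p⟫_ℝ + t ^ 2 * ‖v - p‖ ^ 2) / (2 * γ)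
        = ‖p - u‖ ^ 2 / (2 * γ) +
          (2 * t * ⟪p - u, v - p⟫_ℝ + t ^ 2 * ‖v - p‖ ^ 2) / (2 * γ) := by ring
      rw [this] at h3
      linarith
    rw [le_div_iff₀ (by positivity)] at h4
    have h5 : t * (γ * (gp - gv)) ≤ t * (⟪p - u, v - p⟫_ℝ + t * (‖v - p‖ ^ 2 / 2)) := by
      nlinarith
    exact le_of_mul_le_mul_left h5 ht
  have hlim : Tendsto (fun t : ℝ => ⟪p - u, v - p⟫_ℝ + t * (‖v - p‖ ^ 2 / 2)) (𝓝[>] 0)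
      (𝓝 (⟪p - u, v - p⟫_ℝ + 0 * (‖v - p‖ ^ 2 / 2))) := by
    apply Tendsto.mono_left _ nhdsWithin_le_nhds
    apply Continuous.tendsto
    fun_prop
  rw [zero_mul, add_zero] at hlim
  refine ge_of_tendsto hlim ?_
  have : Set.Ioo (0 : ℝ) 1 ∈ 𝓝[>] (0 : ℝ) := Ioo_mem_nhdsGT one_pos
  filter_upwards [this] with t ht using key t ht.1 ht.2

lemma aux_nonexp (hs : ProxSetting f f' g L prox) {γ : ℝ} (hγ : 0 < γ) (u v : E) :
    ‖prox γ u - prox γ v‖ ≤ ‖u - v‖ := by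
  have h1 := aux_prox_ineq hs hγ u (prox γ v) (aux_prox_ne_top hs hγ v)
  have h2 := aux_prox_ineq hs hγ v (prox γ u) (aux_prox_ne_top hs hγ u)
  set p := prox γ u
  set q := prox γ v
  have h3 : ⟪p - u, q - p⟫_ℝ + ⟪q - v, p - q⟫_ℝ = ⟪u - v, p - q⟫_ℝ - ‖p - q‖ ^ 2 := by
    rw [← real_inner_self_eq_norm_sq]
    simp only [inner_sub_left, inner_sub_right]
    ring
  have h4 := real_inner_le_norm (u - v) (p - q)
  by_contra hc
  push Not at hc
  have : 0 ≤ ‖u - v‖ := norm_nonneg _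
  nlinarith

lemma aux_hasDeriv (hs : ProxSetting f f' g L prox) (x d : E) (t : ℝ) :
    HasDerivAt (fun t : ℝ => f (x + t • d)) ⟪f' (x + t • d), d⟫_ℝ t := by
  have h1 := (hs.f_grad (x + t • d)).hasFDerivAt
  have h2 : HasDerivAt (fun t : ℝ => x + t • d) d t := by
    simpa using ((hasDerivAt_id t).smul_const d).const_add x
  have := h1.comp_hasDerivAt t h2
  simp only [InnerProductSpace.toDual_apply_apply] at this
  exact this

lemma aux_descent_s7 (hs : ProxSetting f f' g L prox) (x y : E) :
    f y ≤ f x + ⟪f' x, y - x⟫_ℝ + L / 2 * ‖y - x‖ ^ 2 := by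
  set d := y - x with hd
  have hder : ∀ t : ℝ, HasDerivAt
      (fun t : ℝ => f (x + t • d) - t * ⟪f' x, d⟫_ℝ - L / 2 * ‖d‖ ^ 2 * t ^ 2)
      (⟪f' (x + t • d), d⟫_ℝ - ⟪f' x, d⟫_ℝ - L / 2 * ‖d‖ ^ 2 * (2 * t)) t := by
    intro t
    have := ((aux_hasDeriv hs x d t).sub ((hasDerivAt_id t).mul_const ⟪f' x, d⟫_ℝ)).sub
      (((hasDerivAt_id t).pow 2).const_mul (L / 2 * ‖d‖ ^ 2))
    simp only [id, one_mul, mul_one, Nat.cast_ofNat, Nat.add_one_sub_one, pow_one] at this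
    exact this
  have hanti : AntitoneOn
      (fun t : ℝ => f (x + t • d) - t * ⟪f' x, d⟫_ℝ - L / 2 * ‖d‖ ^ 2 * t ^ 2) (Set.Icc 0 1) := by
    apply antitoneOn_of_deriv_nonpos (convex_Icc 0 1)
    · exact fun t _ => (hder t).continuousAt.continuousWithinAt
    · exact fun t _ => (hder t).differentiableAt.differentiableWithinAt
    · intro t ht
      rw [interior_Icc] at ht
      rw [(hder t).deriv]
      have h1 := real_inner_le_norm (f' (x + t • d) - f' x) d
      have h2 := hs.lip (x + t • d) x
      rw [add_sub_cancel_left, norm_smul, Real.norm_eq_abs, abs_of_pos ht.1] at h2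
      rw [inner_sub_left] at h1
      nlinarith [norm_nonneg d]
  have := hanti (Set.left_mem_Icc.2 zero_le_one) (Set.right_mem_Icc.2 zero_le_one) zero_le_one
  simp only [one_smul, zero_smul, add_zero] at this
  have hy : x + d = y := by rw [hd]; abel
  rw [hy] at this
  linarith

lemma aux_convex (hs : ProxSetting f f' g L prox) (hf : ConvexOn ℝ Set.univ f) (x y : E) :
    f x + ⟪f' x, y - x⟫_ℝ ≤ f y := by
  have hc : ConvexOn ℝ Set.univ (fun t : ℝ => f (x + t • (y - x))) := by
    refine ⟨convex_univ, fun s _ t _ a b ha hb hab => ?_⟩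
    have := hf.2 (Set.mem_univ (x + s • (y - x))) (Set.mem_univ (x + t • (y - x))) ha hb hab
    convert this using 2
    have hx : x = (a + b) • x := by rw [hab, one_smul]
    simp only [smul_eq_mul]
    nth_rewrite 1 [hx]
    module
  have := hc.le_slope_of_hasDerivAt (Set.mem_univ 0) (Set.mem_univ 1) one_pos
    (aux_hasDeriv hs x (y - x) 0)
  simp [slope_def_field] at this
  linarith

lemma aux_step (hs : ProxSetting f f' g L prox) (hf : ConvexOn ℝ Set.univ f) {γ : ℝ}
    (hγ : 0 < γ) (hγL : γ ≤ 1 / L) (x h v : E) (hv : g v ≠ ⊤) :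
    Freal f g (prox γ (x - γ • h)) - Freal f g v ≤
      1 / (2 * γ) * (‖x - v‖ ^ 2 - ‖prox γ (x - γ • h) - v‖ ^ 2)
        - ⟪prox γ (x - γ • h) - v, h - f' x⟫_ℝ := by
  have h1 := aux_prox_ineq hs hγ (x - γ • h) v hv
  set p := prox γ (x - γ • h)
  have h2 := aux_descent_s7 hs x p
  have h3 := aux_convex hs hf x v
  have hL : γ * L ≤ 1 := by
    have := (le_div_iff₀ hs.L_pos).1 hγL
    exact this
  have e1 : ‖x - v‖ ^ 2 = ‖p - x‖ ^ 2 + ‖p - v‖ ^ 2 + 2 * ⟪p - x, v - p⟫_ℝ := by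
    have : x - v = -((p - x) + (v - p)) := by abel
    rw [this, norm_neg, norm_add_sq_real, norm_sub_rev v p]; ring
  have e2 : ⟪p - (x - γ • h), v - p⟫_ℝ = ⟪p - x, v - p⟫_ℝ - γ * ⟪p - v, h⟫_ℝ := by
    have : p - (x - γ • h) = (p - x) + γ • h := by abel
    rw [this, inner_add_left, real_inner_smul_left, ← neg_sub p v, inner_neg_right h,
      real_inner_comm (p - v) h]
    ring
  have e3 : ⟪p - v, h - f' x⟫_ℝ = ⟪p - v, h⟫_ℝ - ⟪f' x, p - x⟫_ℝ + ⟪f' x, v - x⟫_ℝ := by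
    rw [inner_sub_right, real_inner_comm (f' x) (p - v)]
    simp only [inner_sub_right]
    ring
  have h4 : γ * (L * ‖p - x‖ ^ 2) ≤ ‖p - x‖ ^ 2 := by
    nlinarith [sq_nonneg ‖p - x‖]
  rw [e2] at h1
  have h5 : γ * (f p - f v) ≤
      γ * (⟪f' x, p - x⟫_ℝ - ⟪f' x, v - x⟫_ℝ) + ‖p - x‖ ^ 2 / 2 := by
    nlinarith
  have h6 : γ * (Freal f g p - Freal f g v) ≤
      γ * (1 / (2 * γ) * (‖x - v‖ ^ 2 - ‖p - v‖ ^ 2) - ⟪p - v, h - f' x⟫_ℝ) := by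
    have : γ * (1 / (2 * γ) * (‖x - v‖ ^ 2 - ‖p - v‖ ^ 2) - ⟪p - v, h - f' x⟫_ℝ) =
      (‖x - v‖ ^ 2 - ‖p - v‖ ^ 2) / 2 - γ * ⟪p - v, h - f' x⟫_ℝ := by
      field_simp
    rw [this, e1, e3]
    unfold Freal
    linarith
  exact le_of_mul_le_mul_left h6 hγ

lemma aux_min_ne_top (hs : ProxSetting f f' g L prox) {m : E}
    (hm : ∀ v, Fval f g m ≤ Fval f g v) : g m ≠ ⊤ := by
  intro h
  obtain ⟨v, hv⟩ := hs.g_ne_top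
  have := hm v
  unfold Fval at this
  rw [h, EReal.coe_add_top, top_le_iff] at this
  lift g v to ℝ using ⟨hv, hs.g_ne_bot v⟩ with r
  exact absurd this (by rw [← EReal.coe_add]; exact EReal.coe_ne_top _)

lemma aux_min_le (hs : ProxSetting f f' g L prox) {m : E}
    (hm : ∀ v, Fval f g m ≤ Fval f g v) (v : E) (hv : g v ≠ ⊤) :
    Freal f g m ≤ Freal f g v := by
  have h := hm v
  have hmt := aux_min_ne_top hs hm
  unfold Fval at h
  unfold Freal
  rw [← EReal.coe_toReal hmt (hs.g_ne_bot m), ← EReal.coe_toReal hv (hs.g_ne_bot v)] at h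
  exact_mod_cast h

lemma aux_T_le (hs : ProxSetting f f' g L prox) (hf : ConvexOn ℝ Set.univ f) {γ : ℝ}
    (hγ : 0 < γ) (hγL : γ ≤ 1 / L) (x : E) {m : E} (hm : ∀ v, Fval f g m ≤ Fval f g v) :
    ‖prox γ (x - γ • f' x) - m‖ ≤ ‖x - m‖ := by
  have h1 := aux_step hs hf hγ hγL x (f' x) m (aux_min_ne_top hs hm)
  have h2 := aux_min_le hs hm _ (aux_prox_ne_top hs hγ (x - γ • f' x))
  rw [sub_self (f' x), inner_zero_right, sub_zero] at h1
  have h3 := (sub_nonneg.2 h2).trans h1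
  have h4 := nonneg_of_mul_nonneg_right h3 (by positivity)
  exact abs_le_of_sq_le_sq' (by linarith) (norm_nonneg _) |>.2

lemma aux_step2 (hs : ProxSetting f f' g L prox) (hf : ConvexOn ℝ Set.univ f) {γ : ℝ}
    (hγ : 0 < γ) (hγL : γ ≤ 1 / L) (x h v : E) (hv : g v ≠ ⊤) :
    Freal f g (prox γ (x - γ • h)) - Freal f g v ≤
      1 / (2 * γ) * (‖x - v‖ ^ 2 - ‖prox γ (x - γ • h) - v‖ ^ 2)
        - ⟪prox γ (x - γ • f' x) - v, h - f' x⟫_ℝ + γ * ‖h - f' x‖ ^ 2 := by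
  have h1 := aux_step hs hf hγ hγL x h v hv
  have h2 := aux_nonexp hs hγ (x - γ • f' x) (x - γ • h)
  have e : x - γ • f' x - (x - γ • h) = γ • (h - f' x) := by module
  rw [e, norm_smul, Real.norm_eq_abs, abs_of_pos hγ] at h2
  set p := prox γ (x - γ • h)
  set T := prox γ (x - γ • f' x)
  have h3 := real_inner_le_norm (T - p) (h - f' x)
  have e2 : ⟪T - v, h - f' x⟫_ℝ = ⟪T - p, h - f' x⟫_ℝ + ⟪p - v, h - f' x⟫_ℝ := by
    rw [← inner_add_left]; congr 1; abel
  rw [e2]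
  nlinarith [norm_nonneg (h - f' x)]

lemma aux_abel (c d : ℕ → ℝ) (D : ℝ) (hc : ∀ n, 1 ≤ n → 0 ≤ c n)
    (hmono : ∀ n, 1 ≤ n → c n ≤ c (n + 1)) (hd : ∀ n, d n ≤ D) (n : ℕ) :
    ∑ k ∈ Finset.Icc 1 (n + 1), c k * (d (k - 1) - d k) ≤ c (n + 1) * (D - d (n + 1)) := by
  induction n with
  | zero =>
    simp
    exact mul_le_mul_of_nonneg_left (by linarith [hd 0]) (hc 1 le_rfl)
  | succ n ih =>
    rw [Finset.sum_Icc_succ_top (by omega)]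
    have := hmono (n + 1) (by omega)
    have h2 := hd (n + 1)
    simp only [Nat.add_sub_cancel]
    nlinarith

end Aux

/-- **Corollary 3.5** (rate in expectation for the weighted averages). -/
theorem stmt7
    {E : Type*} [NormedAddCommGroup E] [InnerProductSpace ℝ E] [FiniteDimensional ℝ E]
    (f : E → ℝ) (f' : E → E) (g : E → EReal) (L : ℝ) (prox : ℝ → E → E)
    (hs : ProxSetting f f' g L prox)
    (hfconv : ConvexOn ℝ Set.univ f)
    (hargmin : ∃ m : E, ∀ v : E, Fval f g m ≤ Fval f g v)
    {Ω : Type*} [MeasurableSpace Ω] (μ : Measure Ω) [IsProbabilityMeasure μ]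
    [MeasurableSpace E] [BorelSpace E]
    (γ : ℕ → ℝ) (hγ : ∀ n : ℕ, 1 ≤ n → 0 < γ n ∧ γ n ≤ 1 / L)
    (θ H : ℕ → Ω → E)
    (hθ0 : ∃ c : E, (∀ ω, θ 0 ω = c) ∧ g c ≠ ⊤)
    (hrec : ∀ n : ℕ, ∀ ω, θ (n + 1) ω = prox (γ (n + 1)) (θ n ω - γ (n + 1) • H (n + 1) ω))
    (hHmeas : ∀ n : ℕ, 1 ≤ n → Measurable (H n))
    (hH2 : ∀ n : ℕ, 1 ≤ n → MemLp (H n) 2 μ)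
    (𝓕 : ℕ → MeasurableSpace Ω)
    (h𝓕 : ∀ n : ℕ, 𝓕 n = ⨆ i ∈ Finset.Icc 1 n, MeasurableSpace.comap (H i) inferInstance)
    (eps1 eps2 : ℕ → Ω → ℝ)
    (heps1 : ∀ n : ℕ, eps1 n = fun ω => ‖(μ[fun ω' => H (n + 1) ω' - f' (θ n ω')|𝓕 n]) ω‖)
    (heps2 : ∀ n : ℕ, eps2 n = μ[fun ω' => ‖H (n + 1) ω' - f' (θ n ω')‖ ^ 2|𝓕 n])
    (a : ℕ → ℝ) (ha : ∀ n : ℕ, 1 ≤ n → 0 ≤ a n)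
    (hA : ∀ n : ℕ, 1 ≤ n → 0 < ∑ k ∈ Finset.Icc 1 n, a k)
    (hmono : ∀ n : ℕ, 1 ≤ n → a n / γ n ≤ a (n + 1) / γ (n + 1))
    (B : ℝ) (hB : ∀ᵐ ω ∂μ, ∀ n, ‖θ n ω‖ ≤ B) :
    ∀ θs : E, (∀ v : E, Fval f g θs ≤ Fval f g v) → ∀ n : ℕ, 1 ≤ n →
      (1 / ∑ k ∈ Finset.Icc 1 n, a k) *
          (∑ k ∈ Finset.Icc 1 n, a k * ∫ ω, Freal f g (θ k ω) ∂μ) - Freal f g θs ≤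
        (B + ‖θs‖) ^ 2 * a n / (2 * γ n * ∑ k ∈ Finset.Icc 1 n, a k) +
          (1 / ∑ k ∈ Finset.Icc 1 n, a k) *
            ∑ k ∈ Finset.Icc 1 n,
              a k * ((B + ‖θs‖) * (∫ ω, eps1 (k - 1) ω ∂μ) +
                γ k * ∫ ω, eps2 (k - 1) ω ∂μ) := by
  intro θs hθs n hn
  have hBpos : 0 ≤ B := by
    obtain ⟨ω, hω⟩ := hB.exists
    exact (norm_nonneg _).trans (hω 0)
  have hfc : Continuous f' := by
    have : LipschitzWith L.toNNReal f' := by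
      apply LipschitzWith.of_dist_le_mul
      intro x y
      rw [dist_eq_norm, dist_eq_norm, Real.coe_toNNReal _ hs.L_pos.le]
      exact hs.lip x y
    exact this.continuous
  have hpc : ∀ c : ℝ, 0 < c → Continuous (prox c) := by
    intro c hc
    have : LipschitzWith 1 (prox c) := by
      apply LipschitzWith.of_dist_le_mul
      intro x y
      rw [dist_eq_norm, dist_eq_norm, NNReal.coe_one, one_mul]
      exact aux_nonexp hs hc x y
    exact this.continuous
  have hFle : ∀ k, 𝓕 k ≤ (inferInstance : MeasurableSpace Ω) := by
    intro k
    rw [h𝓕]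
    refine iSup₂_le fun i hi => ?_
    exact (hHmeas i (Finset.mem_Icc.1 hi).1).comap_le
  have hFmono : ∀ k, 𝓕 k ≤ 𝓕 (k + 1) := by
    intro k
    rw [h𝓕, h𝓕]
    refine iSup₂_le fun i hi => ?_
    have hi' : i ∈ Finset.Icc 1 (k + 1) := by
      rw [Finset.mem_Icc] at hi ⊢; omega
    exact le_iSup₂_of_le i hi' le_rfl
  have hHF : ∀ k, Measurable[𝓕 (k + 1)] (H (k + 1)) := by
    intro k
    rw [measurable_iff_comap_le, h𝓕]
    exact le_iSup₂_of_le (k + 1) (by rw [Finset.mem_Icc]; omega) le_rfl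
  have hθF : ∀ k, Measurable[𝓕 k] (θ k) := by
    intro k
    induction k with
    | zero =>
      obtain ⟨c, hc, -⟩ := hθ0
      have : θ 0 = fun _ => c := funext hc
      rw [this]
      exact measurable_const
    | succ k ih =>
      have e : θ (k + 1) = fun ω => prox (γ (k + 1)) (θ k ω - γ (k + 1) • H (k + 1) ω) :=
        funext (hrec k)
      rw [e]
      have h1 : Measurable[𝓕 (k + 1)] (θ k) := ih.mono (hFmono k) le_rfl
      exact (hpc _ (hγ (k + 1) (by omega)).1).measurable.comp
        (h1.sub ((hHF k).const_smul (γ (k + 1))))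
  have hθm : ∀ k, Measurable (θ k) := fun k => (hθF k).mono (hFle k) le_rfl
  have hgm : Measurable fun x => (g x).toReal := hs.g_lsc.measurable.ereal_toReal
  have hfm : Continuous f :=
    continuous_iff_continuousAt.2 fun x => (hs.f_grad x).hasFDerivAt.continuousAt
  have hst := aux_min_ne_top hs hθs
  set BS := B + ‖θs‖ with hBS
  have hBS0 : 0 ≤ BS := by positivity
  have hdist : ∀ᵐ ω ∂μ, ∀ k, ‖θ k ω - θs‖ ≤ BS := by
    filter_upwards [hB] with ω hω k
    exact (norm_sub_le _ _).trans (by rw [hBS]; linarith [hω k])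
  set d : ℕ → ℝ := fun k => ∫ ω, ‖θ k ω - θs‖ ^ 2 ∂μ with hd
  have hdint : ∀ k, Integrable (fun ω => ‖θ k ω - θs‖ ^ 2) μ := by
    intro k
    refine Integrable.of_bound
      (((hθm k).sub_const θs).norm.pow_const 2).aestronglyMeasurable (BS ^ 2) ?_
    filter_upwards [hdist] with ω hω
    rw [Real.norm_eq_abs, abs_of_nonneg (by positivity)]
    exact pow_le_pow_left₀ (norm_nonneg _) (hω k) 2
  have hd0 : ∀ k, 0 ≤ d k := fun k => integral_nonneg fun ω => by positivity
  have hdD : ∀ k, d k ≤ BS ^ 2 := by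
    intro k
    have : d k ≤ ∫ _ω, BS ^ 2 ∂μ := by
      refine integral_mono_ae (hdint k) (integrable_const _) ?_
      filter_upwards [hdist] with ω hω
      exact pow_le_pow_left₀ (norm_nonneg _) (hω k) 2
    simpa using this
  have step : ∀ k, 1 ≤ k → (∫ ω, Freal f g (θ k ω) ∂μ) - Freal f g θs ≤
      1 / (2 * γ k) * (d (k - 1) - d k) + (BS * (∫ ω, eps1 (k - 1) ω ∂μ) +
        γ k * ∫ ω, eps2 (k - 1) ω ∂μ) := by
    intro k hk
    obtain ⟨k, rfl⟩ : ∃ j, k = j + 1 := ⟨k - 1, by omega⟩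
    obtain ⟨hγ0, hγL⟩ := hγ (k + 1) hk
    rw [Nat.add_sub_cancel]
    set c := γ (k + 1)
    set η : Ω → E := fun ω => H (k + 1) ω - f' (θ k ω) with hη
    set X : Ω → E := fun ω => prox c (θ k ω - c • f' (θ k ω)) - θs with hX
    have hXF : Measurable[𝓕 k] X :=
      (((hpc c hγ0).comp (continuous_id.sub (hfc.const_smul c))).sub
        continuous_const).measurable.comp (hθF k)
    have hXb : ∀ᵐ ω ∂μ, ‖X ω‖ ≤ BS := by
      filter_upwards [hdist] with ω hω
      exact (aux_T_le hs hfconv hγ0 hγL _ hθs).trans (hω k)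
    have hη2 : MemLp η 2 μ := by
      refine (hH2 (k + 1) hk).sub ?_
      refine MemLp.of_bound (hfc.measurable.comp (hθm k)).aestronglyMeasurable
        (‖f' θs‖ + L * BS) ?_
      filter_upwards [hdist] with ω hω
      have h1 := hs.lip (θ k ω) θs
      have h2 : ‖f' (θ k ω)‖ ≤ ‖f' θs‖ + ‖f' (θ k ω) - f' θs‖ := by
        have := norm_add_le (f' θs) (f' (θ k ω) - f' θs)
        simpa using this
      have h3 := mul_le_mul_of_nonneg_left (hω k) hs.L_pos.le
      linarith
    have hη1 : Integrable η μ := hη2.integrable one_le_two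
    have hηsq : Integrable (fun ω => ‖η ω‖ ^ 2) μ := hη2.integrable_norm_pow two_ne_zero
    have hXm : Measurable X := hXF.mono (hFle k) le_rfl
    have hXη : Integrable (fun ω => ⟪X ω, η ω⟫_ℝ) μ := by
      refine Integrable.mono' (hη1.norm.const_mul BS)
        (hXm.aestronglyMeasurable.inner hη1.aestronglyMeasurable) ?_
      filter_upwards [hXb] with ω hω
      exact (norm_inner_le_norm _ _).trans
        (mul_le_mul_of_nonneg_right hω (norm_nonneg _))
    have hpt : ∀ ω, Freal f g (θ (k + 1) ω) - Freal f g θs ≤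
        1 / (2 * c) * (‖θ k ω - θs‖ ^ 2 - ‖θ (k + 1) ω - θs‖ ^ 2)
          - ⟪X ω, η ω⟫_ℝ + c * ‖η ω‖ ^ 2 := by
      intro ω
      rw [hrec k ω]
      exact aux_step2 hs hfconv hγ0 hγL _ _ _ hst
    have hi1 : Integrable (fun ω =>
        1 / (2 * c) * (‖θ k ω - θs‖ ^ 2 - ‖θ (k + 1) ω - θs‖ ^ 2)) μ :=
      ((hdint k).sub (hdint (k + 1))).const_mul _
    have hi2 : Integrable (fun ω =>
        1 / (2 * c) * (‖θ k ω - θs‖ ^ 2 - ‖θ (k + 1) ω - θs‖ ^ 2) - ⟪X ω, η ω⟫_ℝ) μ :=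
      hi1.sub hXη
    have hRint : Integrable (fun ω =>
        1 / (2 * c) * (‖θ k ω - θs‖ ^ 2 - ‖θ (k + 1) ω - θs‖ ^ 2)
          - ⟪X ω, η ω⟫_ℝ + c * ‖η ω‖ ^ 2) μ :=
      ((((hdint k).sub (hdint (k + 1))).const_mul _).sub hXη).add (hηsq.const_mul c)
    have hFm : Measurable fun ω => Freal f g (θ (k + 1) ω) :=
      (hfm.measurable.add hgm).comp (hθm (k + 1))
    have hFint : Integrable (fun ω => Freal f g (θ (k + 1) ω) - Freal f g θs) μ := by
      refine Integrable.mono' hRint (hFm.sub_const _).aestronglyMeasurable ?_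
      filter_upwards with ω
      have h0 : Freal f g θs ≤ Freal f g (θ (k + 1) ω) := by
        refine aux_min_le hs hθs _ ?_
        rw [hrec k ω]
        exact aux_prox_ne_top hs hγ0 _
      rw [Real.norm_eq_abs, abs_of_nonneg (sub_nonneg.2 h0)]
      exact hpt ω
    have hFint' : Integrable (fun ω => Freal f g (θ (k + 1) ω)) μ := by
      have := hFint.add (integrable_const (Freal f g θs))
      refine this.congr (ae_of_all _ fun ω => ?_)
      simp
    have hI := integral_mono hFint hRint hpt
    rw [integral_sub hFint' (integrable_const _), integral_const, probReal_univ, one_smul,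
      integral_add hi2 (hηsq.const_mul c),
      integral_sub hi1 hXη,
      integral_const_mul, integral_const_mul, integral_sub (hdint k) (hdint (k + 1))] at hI
    have he2 : ∫ ω, eps2 k ω ∂μ = ∫ ω, ‖η ω‖ ^ 2 ∂μ := by
      rw [heps2]
      exact integral_condExp (hFle k)
    have hce := condExp_bilin_of_stronglyMeasurable_left (μ := μ) (innerSL ℝ (E := E))
      (m := 𝓕 k) (f := X) (g := η) hXF.stronglyMeasurable hXη hη1
    have he1 : -∫ ω, ⟪X ω, η ω⟫_ℝ ∂μ ≤ BS * ∫ ω, eps1 k ω ∂μ := by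
      have h1 : ∫ ω, ⟪X ω, η ω⟫_ℝ ∂μ = ∫ ω, ⟪X ω, (μ[η|𝓕 k]) ω⟫_ℝ ∂μ := by
        rw [← integral_condExp (hFle k)]
        exact integral_congr_ae hce
      rw [h1, heps1, ← integral_const_mul, ← integral_neg]
      refine integral_mono_ae ?_ (integrable_condExp.norm.const_mul BS) ?_
      · exact ((integrable_condExp (m := 𝓕 k) (μ := μ)).congr hce).neg
      · filter_upwards [hXb] with ω hω
        have h2 := abs_real_inner_le_norm (X ω) ((μ[η|𝓕 k]) ω)
        have h3 := mul_le_mul_of_nonneg_right hω (norm_nonneg ((μ[η|𝓕 k]) ω))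
        exact (neg_le_abs _).trans (h2.trans h3)
    rw [he2]
    simp only [hd]
    linarith
  have hAn := hA n hn
  set A := ∑ k ∈ Finset.Icc 1 n, a k with hAdef
  have hsum : ∑ k ∈ Finset.Icc 1 n, a k * (∫ ω, Freal f g (θ k ω) ∂μ) - A * Freal f g θs ≤
      ∑ k ∈ Finset.Icc 1 n, (a k / γ k / 2) * (d (k - 1) - d k) +
      ∑ k ∈ Finset.Icc 1 n, a k * (BS * (∫ ω, eps1 (k - 1) ω ∂μ) +
        γ k * ∫ ω, eps2 (k - 1) ω ∂μ) := by
    rw [hAdef, Finset.sum_mul, ← Finset.sum_sub_distrib, ← Finset.sum_add_distrib]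
    refine Finset.sum_le_sum fun k hk => ?_
    have hk1 := (Finset.mem_Icc.1 hk).1
    have := mul_le_mul_of_nonneg_left (step k hk1) (ha k hk1)
    have e : a k * (1 / (2 * γ k) * (d (k - 1) - d k)) = a k / γ k / 2 * (d (k - 1) - d k) := by
      have := (hγ k hk1).1.ne'
      field_simp
    rw [mul_add, e, mul_sub] at this
    exact this
  have hab : ∑ k ∈ Finset.Icc 1 n, (a k / γ k / 2) * (d (k - 1) - d k) ≤
      a n / γ n / 2 * BS ^ 2 := by
    obtain ⟨j, rfl⟩ : ∃ j, n = j + 1 := ⟨n - 1, by omega⟩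
    have hc0 : ∀ k, 1 ≤ k → 0 ≤ a k / γ k / 2 := fun k hk =>
      div_nonneg (div_nonneg (ha k hk) (hγ k hk).1.le) zero_le_two
    refine (aux_abel (fun k => a k / γ k / 2) d (BS ^ 2) hc0
      (fun k hk => by have := hmono k hk; linarith) hdD j).trans ?_
    exact mul_le_mul_of_nonneg_left (by linarith [hd0 (j + 1)]) (hc0 _ hn)
  have hγn := (hγ n hn).1
  set R := ∑ k ∈ Finset.Icc 1 n, a k * (BS * (∫ ω, eps1 (k - 1) ω ∂μ) +
        γ k * ∫ ω, eps2 (k - 1) ω ∂μ)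
  set S := ∑ k ∈ Finset.Icc 1 n, a k * (∫ ω, Freal f g (θ k ω) ∂μ)
  have hfin := mul_le_mul_of_nonneg_left (hsum.trans (add_le_add_left hab R))
    (one_div_pos.2 hAn).le
  have e1 : 1 / A * (S - A * Freal f g θs) = 1 / A * S - Freal f g θs := by
    field_simp
  have e2 : 1 / A * (a n / γ n / 2 * BS ^ 2 + R) =
      BS ^ 2 * a n / (2 * γ n * A) + 1 / A * R := by
    field_simp
  rw [e1, e2] at hfin
  exact hfin
end
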